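/- The process X = 2K − B is not Markov: there exist times 0 ≤ s ≤ t such that σ(X(t)) is not conditionally independent of σ(X(u) : 0 ≤ u ≤ s) given σ(X(s)). -/

import Mathlib

open MeasureTheory ProbabilityTheory Set Filter Topology
open scoped Classical

noncomputable section

/-- The σ-algebra generated by a process `Y` up to time `t` (over times in `[0, t]`),
i.e. `σ(Y u : 0 ≤ u ≤ t)`. -/
def natSigma {Ω E : Type*} [MeasurableSpace E] (Y : ℝ → Ω → E) (t : ℝ) :
    MeasurableSpace Ω :=
  ⨆ u : Set.Icc (0 : ℝ) t, MeasurableSpace.comap (Y u) inferInstance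

/-- The σ-algebra generated by the whole (nonnegative-time) process `Y`. -/
def procSigma {Ω E : Type*} [MeasurableSpace E] (Y : ℝ → Ω → E) :
    MeasurableSpace Ω :=
  ⨆ u : Set.Ici (0 : ℝ), MeasurableSpace.comap (Y u) inferInstance

/-- `B` is a standard one-dimensional Brownian motion (with `B 0 = 0`) under `P`:
measurable, a.s. starting at `0` and continuous on `[0, ∞)`, with Gaussian increments
`B t - B s ~ N(0, t - s)` that are independent of the past. -/
structure IsBrownianMotion {Ω : Type*} [MeasurableSpace Ω] (P : Measure Ω)
    (B : ℝ → Ω → ℝ) : Prop where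
  measurable : ∀ t : ℝ, Measurable (B t)
  init : ∀ᵐ ω ∂P, B 0 ω = 0
  cont : ∀ᵐ ω ∂P, ContinuousOn (fun t => B t ω) (Set.Ici 0)
  incr_law : ∀ s t : ℝ, 0 ≤ s → s ≤ t →
    P.map (fun ω => B t ω - B s ω) = gaussianReal 0 (Real.toNNReal (t - s))
  incr_indep : ∀ s t : ℝ, 0 ≤ s → s ≤ t →
    Indep (MeasurableSpace.comap (fun ω => B t ω - B s ω) inferInstance)
      (natSigma B s) P

/-- `W` is a standard `n`-dimensional Brownian motion started at the origin:
its coordinate processes are independent standard one-dimensional Brownian motions. -/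
def IsBrownianMotionND {Ω : Type*} [MeasurableSpace Ω] (P : Measure Ω) {n : ℕ}
    (W : ℝ → Ω → EuclideanSpace ℝ (Fin n)) : Prop :=
  (∀ i : Fin n, IsBrownianMotion P (fun t ω => W t ω i)) ∧
  iIndep (fun i : Fin n => procSigma (fun t ω => W t ω i)) P

/-- The least concave majorant on `[0, ∞)` of a function `f : ℝ → ℝ`:
`t ↦ inf { c t | c concave on [0,∞) and c ≥ f on [0,∞) }`. -/
def concaveMajorant (f : ℝ → ℝ) (t : ℝ) : ℝ :=
  sInf {y | ∃ c : ℝ → ℝ, ConcaveOn ℝ (Set.Ici 0) c ∧ (∀ u, 0 ≤ u → f u ≤ c u) ∧ y = c t}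

/-- Right-hand derivative. -/
def rightDeriv (f : ℝ → ℝ) (t : ℝ) : ℝ := derivWithin f (Set.Ioi t) t

/-- `D(t)`: the first vertex (contact point of the concave majorant) at or after time `t`. -/
def firstVertex (f : ℝ → ℝ) (t : ℝ) : ℝ :=
  sInf {u | t ≤ u ∧ concaveMajorant f u = f u}

/-- The concave majorant process `K` of `B`. -/
def Kproc {Ω : Type*} (B : ℝ → Ω → ℝ) (t : ℝ) (ω : Ω) : ℝ :=
  concaveMajorant (fun u => B u ω) t

/-- The process `X = 2K - B`. -/
def Xproc {Ω : Type*} (B : ℝ → Ω → ℝ) (t : ℝ) (ω : Ω) : ℝ :=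
  2 * Kproc B t ω - B t ω

/-- The right-hand slope process `K'` of the concave majorant. -/
def Kslope {Ω : Type*} (B : ℝ → Ω → ℝ) (t : ℝ) (ω : Ω) : ℝ :=
  rightDeriv (fun u => Kproc B u ω) t

/-- The process `D` of first vertices: `D(t) = inf {u ≥ t : K u = B u}`. -/
def Dproc {Ω : Type*} (B : ℝ → Ω → ℝ) (t : ℝ) (ω : Ω) : ℝ :=
  firstVertex (fun u => B u ω) t

/-- A process `Y` is Markov (w.r.t. its natural filtration): for all `0 ≤ s ≤ t`,
`σ(Y t)` is conditionally independent of `σ(Y u : 0 ≤ u ≤ s)` given `σ(Y s)`. -/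
def IsMarkov {Ω E : Type*} [mΩ : MeasurableSpace Ω] [StandardBorelSpace Ω]
    [MeasurableSpace E] (P : Measure Ω) [IsFiniteMeasure P] (Y : ℝ → Ω → E) : Prop :=
  ∀ s t : ℝ, 0 ≤ s → s ≤ t →
    ∃ hs : MeasurableSpace.comap (Y s) inferInstance ≤ mΩ,
      CondIndep (MeasurableSpace.comap (Y s) inferInstance)
        (MeasurableSpace.comap (Y t) inferInstance)
        (natSigma Y s) hs P

section part1
open scoped NNReal ENNReal
set_option linter.unusedSectionVars false
variable {Ω : Type*} {mΩ : MeasurableSpace Ω} {P : Measure Ω} {B : ℝ → Ω → ℝ}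

lemma natSigma_le_of_meas (hm : ∀ t, Measurable (B t)) (s : ℝ) : natSigma B s ≤ ‹MeasurableSpace Ω› :=
  iSup_le fun u => (hm u).comap_le

lemma meas_natSigma {s u : ℝ} (h0 : 0 ≤ u) (hu : u ≤ s) : Measurable[natSigma B s] (B u) := by
  have : MeasurableSpace.comap (B u) inferInstance ≤ natSigma B s :=
    le_iSup (fun u : Set.Icc (0:ℝ) s => MeasurableSpace.comap (B u) inferInstance) ⟨u, h0, hu⟩
  exact (comap_measurable (B u)).mono this le_rfl

lemma natSigma_mono {s t : ℝ} (h : s ≤ t) : natSigma B s ≤ natSigma B t :=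
  iSup_le fun u => (meas_natSigma u.2.1 (u.2.2.trans h)).comap_le

lemma meas_procSigma {u : ℝ} (h0 : 0 ≤ u) : Measurable[procSigma B] (B u) := by
  have : MeasurableSpace.comap (B u) inferInstance ≤ procSigma B :=
    le_iSup (fun u : Set.Ici (0:ℝ) => MeasurableSpace.comap (B u) inferInstance) ⟨u, h0⟩
  exact (comap_measurable (B u)).mono this le_rfl

lemma procSigma_le_of_meas (hm : ∀ t, Measurable (B t)) : procSigma B ≤ ‹MeasurableSpace Ω› :=
  iSup_le fun u => (hm u).comap_le

/-- Restriction to nonnegative times is pre-Brownian in the sense of Mathlib. -/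
lemma IsBrownianMotion.pre [IsProbabilityMeasure P] (hB : IsBrownianMotion P B) :
    IsPreBrownianReal (fun (t : ℝ≥0) ω => B t ω) P := by
  apply HasIndepIncrements.isPreBrownianReal_of_hasLaw
  · intro t
    refine ⟨(hB.measurable t).aemeasurable, ?_⟩
    have h := hB.incr_law 0 t le_rfl t.2
    rw [← show (Real.toNNReal ((t : ℝ) - 0)) = t by simp, ← h]
    apply Measure.map_congr
    filter_upwards [hB.init] with ω hω
    simp [hω]
  · refine HasIndepIncrements.of_nat fun t ht _ => ?_
    rw [iIndepFun_iff_measure_inter_preimage_eq_mul]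
    intro S
    induction S using Finset.induction_on_max with
    | empty => intro sets _; simp
    | insert a s hs ih =>
      intro sets hsets
      have hna : a ∉ s := fun h => lt_irrefl _ (hs a h)
      rw [Finset.prod_insert hna, ← ih (fun i hi => hsets i (Finset.mem_insert_of_mem hi)),
        Finset.set_biInter_insert]
      have hind := hB.incr_indep (t a) (t (a+1)) (t a).2 (ht (Nat.le_succ a))
      rw [Indep_iff] at hind
      apply hind
      · exact ⟨sets a, hsets a (Finset.mem_insert_self _ _), rfl⟩
      · refine Finset.measurableSet_biInter _ fun i hi => ?_
        have hlt := hs i hi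
        refine ((meas_natSigma (B := B) (t (i+1)).2 (ht hlt)).sub
          (meas_natSigma (t i).2 (ht hlt.le))) (hsets i (Finset.mem_insert_of_mem hi))

lemma IsBrownianMotion.shift (hB : IsBrownianMotion P B) {s : ℝ} (hs : 0 ≤ s) :
    IsBrownianMotion P (fun v ω => B (s + v) ω - B s ω) where
  measurable t := (hB.measurable _).sub (hB.measurable _)
  init := by simp
  cont := by
    filter_upwards [hB.cont] with ω h
    refine ContinuousOn.sub (h.comp (by fun_prop) ?_) continuousOn_const
    intro v hv
    simp only [mem_Ici] at *
    positivity
  incr_law u t hu hut := by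
    have := hB.incr_law (s+u) (s+t) (by positivity) (by linarith)
    simpa using this
  incr_indep u t hu hut := by
    have := hB.incr_indep (s+u) (s+t) (by positivity) (by linarith)
    simp only [sub_sub_sub_cancel_right]
    refine indep_of_indep_of_le_right this ?_
    refine iSup_le fun v => ?_
    refine Measurable.comap_le ?_
    exact (meas_natSigma (by have := v.2.1; positivity) (by have := v.2.2; linarith)).sub
      (meas_natSigma hs (by linarith))

lemma IsBrownianMotion.indep_shift [IsProbabilityMeasure P] (hB : IsBrownianMotion P B) {s : ℝ}
    (hs : 0 ≤ s) :
    Indep (procSigma (fun v ω => B (s + v) ω - B s ω)) (natSigma B s) P := by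
  have h := hB.pre.indepFun_shift ⟨s, hs⟩
  refine indep_of_indep_of_le_left (indep_of_indep_of_le_right h ?_) ?_
  · refine iSup_le fun v => ?_
    refine Measurable.comap_le ?_
    let m : MeasurableSpace Ω := MeasurableSpace.comap (fun ω (t : Set.Iic (⟨s, hs⟩ : ℝ≥0)) ↦ B t ω) inferInstance
    have h1 : Measurable[m] (fun ω (t : Set.Iic (⟨s, hs⟩ : ℝ≥0)) ↦ B t ω) := comap_measurable _
    exact (measurable_pi_apply (⟨⟨v, v.2.1⟩, v.2.2⟩ : Set.Iic (⟨s, hs⟩ : ℝ≥0))).comp h1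
  · refine iSup_le fun v => ?_
    refine Measurable.comap_le ?_
    have h1 := comap_measurable (m := MeasurableSpace.pi) (fun ω (t : ℝ≥0) ↦ B ((⟨s, hs⟩ + t : ℝ≥0) : ℝ) ω - B s ω)
    exact (measurable_pi_apply (⟨v, v.2⟩ : ℝ≥0)).comp h1

/-- A linear functional of three values is independent of corrected values. -/
lemma IsBrownianMotion.indep_lin [IsProbabilityMeasure P] (hB : IsBrownianMotion P B)
    {ι : Type*} (a b c : ℝ≥0) (α β γ : ℝ) (τ : ι → ℝ≥0) (κ : ι → ℝ) (V : ℝ)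
    (hV : V = α * (α * min a a + β * min a b + γ * min a c) +
      β * (α * min b a + β * min b b + γ * min b c) +
      γ * (α * min c a + β * min c b + γ * min c c))
    (hcov : ∀ i, α * min a (τ i) + β * min b (τ i) + γ * min c (τ i) = κ i * V) :
    IndepFun (fun ω => α * B a ω + β * B b ω + γ * B c ω)
      (fun ω i => B (τ i) ω - κ i * (α * B a ω + β * B b ω + γ * B c ω)) P ∧
    P.map (fun ω => α * B a ω + β * B b ω + γ * B c ω) = gaussianReal 0 V.toNNReal := by
  have hp := hB.pre
  have hL2 : ∀ t : ℝ≥0, MemLp (B t) 2 P := fun t => (hp.isGaussianProcess.hasGaussianLaw_eval t).memLp_two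
  have hcv : ∀ s t : ℝ≥0, cov[B s, B t; P] = min s t := fun s t => hp.covariance_eval s t
  set ζ : Ω → ℝ := α • B a + β • B b + γ • B c with hζ
  have hζ' : (fun ω => α * B a ω + β * B b ω + γ * B c ω) = ζ := by
    ext ω; simp [hζ]
  have hζ2 : MemLp ζ 2 P := (((hL2 a).const_smul α).add ((hL2 b).const_smul β)).add ((hL2 c).const_smul γ)
  have hcζ : ∀ t : ℝ≥0, cov[ζ, B t; P] = α * min a t + β * min b t + γ * min c t := by
    intro t
    rw [hζ, covariance_add_left (((hL2 a).const_smul α).add ((hL2 b).const_smul β)) ((hL2 c).const_smul γ) (hL2 t),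
      covariance_add_left ((hL2 a).const_smul α) ((hL2 b).const_smul β) (hL2 t),
      covariance_smul_left, covariance_smul_left, covariance_smul_left, hcv, hcv, hcv]
  have hVar : cov[ζ, ζ; P] = V := by
    conv_lhs => arg 2; rw [hζ]
    rw [covariance_add_right hζ2 (((hL2 a).const_smul α).add ((hL2 b).const_smul β)) ((hL2 c).const_smul γ),
      covariance_add_right hζ2 ((hL2 a).const_smul α) ((hL2 b).const_smul β),
      covariance_smul_right, covariance_smul_right, covariance_smul_right, hcζ, hcζ, hcζ, hV]
    simp only [min_comm b a, min_comm c a, min_comm c b]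
  have hgp : IsGaussianProcess (Sum.elim (fun (_ : Unit) => ζ) (fun i ω => B (τ i) ω - κ i * ζ ω)) P := by
    apply hp.isGaussianProcess.of_isGaussianProcess
    rintro (t | i)
    · refine ⟨{a, b, c},
        { toFun x := α * x ⟨a, by simp⟩ + β * x ⟨b, by simp⟩ + γ * x ⟨c, by simp⟩
          map_add' x y := by simp; ring
          map_smul' c x := by simp; ring }, ?_⟩
      intro ω; simp [hζ]
    · refine ⟨{a, b, c, τ i},
        { toFun x := x ⟨τ i, by simp⟩ - κ i * (α * x ⟨a, by simp⟩ + β * x ⟨b, by simp⟩ + γ * x ⟨c, by simp⟩)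
          map_add' x y := by simp; ring
          map_smul' c x := by simp; ring }, ?_⟩
      intro ω; simp [hζ]
  have hmζ : Measurable ζ := by
    rw [← hζ']
    have := hB.measurable a; have := hB.measurable b; have := hB.measurable c
    fun_prop
  rw [hζ']
  constructor
  · have hind := IsGaussianProcess.indepFun_of_covariance_eq_zero (P := P)
      (X := fun (_ : Unit) => ζ) (Y := fun i ω => B (τ i) ω - κ i * ζ ω) hgp
      (fun _ => hmζ.aemeasurable)
      (fun i => ((hB.measurable _).sub (hmζ.const_mul _)).aemeasurable) ?_
    · have hm1 : Measurable (fun f : Unit → ℝ => f ()) := measurable_pi_apply ()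
      have hm2 : Measurable (id : (ι → ℝ) → (ι → ℝ)) := measurable_id
      have := hind.comp hm1 hm2
      have e : (fun ω i => B (τ i) ω - κ i * (α * B a ω + β * B b ω + γ * B c ω)) =
          id ∘ fun ω t => B (τ t) ω - κ t * ζ ω := by
        funext ω i
        simp [hζ]
      rw [e]
      exact this
    · rintro _ i
      have : (fun ω => B (τ i) ω - κ i * ζ ω) = B (τ i) - κ i • ζ := by ext; simp
      rw [this, covariance_sub_right hζ2 (hL2 _) (hζ2.const_smul _), covariance_smul_right, hVar, hcζ, hcov]
      simp
  · have hg : HasGaussianLaw ζ P := hgp.hasGaussianLaw_eval (Sum.inl ())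
    rw [hg.map_eq_gaussianReal, ← covariance_self hmζ.aemeasurable, hVar]
    congr 1
    have hi : ∀ t : ℝ≥0, Integrable (B t) P := fun t => hp.integrable_eval t
    have h0 : ∀ t : ℝ≥0, ∫ ω, B t ω ∂P = 0 := fun t => hp.integral_eval t
    rw [← hζ']
    have e1 : Integrable (fun ω => α * B a ω + β * B b ω) P := ((hi a).const_mul _).add ((hi b).const_mul _)
    show ∫ ω, (α * B a ω + β * B b ω + γ * B c ω) ∂P = 0
    rw [integral_add e1 ((hi c).const_mul _),
      integral_add ((hi a).const_mul _) ((hi b).const_mul _), integral_const_mul, integral_const_mul,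
      integral_const_mul, h0, h0, h0]
    simp

end part1

section part2
open scoped NNReal ENNReal
set_option linter.unusedSectionVars false
variable {Ω : Type*} {mΩ : MeasurableSpace Ω} {P : Measure Ω}

/-- Fubini for independent variables. -/
lemma indepFun_lint [IsProbabilityMeasure P] {α β : Type*} [MeasurableSpace α] [MeasurableSpace β]
    {X : Ω → α} {Y : Ω → β} (hX : Measurable X) (hY : Measurable Y) (h : IndepFun X Y P)
    {R : Set (α × β)} (hR : MeasurableSet R) :
    P {ω | (X ω, Y ω) ∈ R} = ∫⁻ ω, P {ω' | (X ω, Y ω') ∈ R} ∂P := by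
  have h1 := (indepFun_iff_map_prod_eq_prod_map_map hX.aemeasurable hY.aemeasurable).1 h
  have h2 : P {ω | (X ω, Y ω) ∈ R} = P.map (fun ω => (X ω, Y ω)) R := by
    rw [Measure.map_apply (hX.prodMk hY) hR]; rfl
  have : IsProbabilityMeasure (P.map Y) := Measure.isProbabilityMeasure_map hY.aemeasurable
  rw [h2, h1, Measure.prod_apply hR, lintegral_map (measurable_measure_prodMk_left hR) hX]
  refine lintegral_congr fun ω => ?_
  rw [Measure.map_apply hY (measurable_prodMk_left hR)]
  rfl

lemma indep_lint [IsProbabilityMeasure P] {α β : Type*} [MeasurableSpace α] [MeasurableSpace β]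
    {m1 m2 : MeasurableSpace Ω} (hm1 : m1 ≤ mΩ) (hm2 : m2 ≤ mΩ) (h : Indep m2 m1 P)
    {X : Ω → α} {Y : Ω → β} (hX : Measurable[m1] X) (hY : Measurable[m2] Y)
    {E : Set Ω} (hE : MeasurableSet[m1] E)
    {R : Set (α × β)} (hR : MeasurableSet R) :
    P (E ∩ {ω | (X ω, Y ω) ∈ R}) = ∫⁻ ω in E, P {ω' | (X ω, Y ω') ∈ R} ∂P := by
  have hI : Measurable[m1] (fun ω => (E.indicator (fun _ => (1:ℝ)) ω, X ω)) :=
    Measurable.prodMk (measurable_const.indicator hE) hX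
  have hind : IndepFun (fun ω => (E.indicator (fun _ => (1:ℝ)) ω, X ω)) Y P := by
    have h' := h.symm
    exact indep_of_indep_of_le_left (indep_of_indep_of_le_right h' hY.comap_le) hI.comap_le
  have hR' : MeasurableSet {p : (ℝ × α) × β | p.1.1 = 1 ∧ (p.1.2, p.2) ∈ R} := by
    refine MeasurableSet.inter ?_ ?_
    · exact (measurable_fst.comp measurable_fst) (measurableSet_singleton (1:ℝ))
    · exact ((measurable_snd.comp measurable_fst).prodMk measurable_snd) hR
  have key := indepFun_lint (hI.mono hm1 le_rfl) (hY.mono hm2 le_rfl) hind hR'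
  have e1 : {ω | ((E.indicator (fun _ => (1:ℝ)) ω, X ω), Y ω) ∈
      {p : (ℝ × α) × β | p.1.1 = 1 ∧ (p.1.2, p.2) ∈ R}} = E ∩ {ω | (X ω, Y ω) ∈ R} := by
    ext ω
    by_cases hω : ω ∈ E <;> simp [hω]
  rw [e1] at key
  rw [key, ← lintegral_indicator (hm1 _ hE)]
  refine lintegral_congr fun ω => ?_
  by_cases hω : ω ∈ E <;> simp [hω]

lemma indep_le [IsProbabilityMeasure P] {α β : Type*} [MeasurableSpace α] [MeasurableSpace β]
    {m1 m2 : MeasurableSpace Ω} (hm1 : m1 ≤ mΩ) (hm2 : m2 ≤ mΩ) (h : Indep m2 m1 P)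
    {X : Ω → α} {Y : Ω → β} (hX : Measurable[m1] X) (hY : Measurable[m2] Y)
    {E : Set Ω} (hE : MeasurableSet[m1] E)
    {R : Set (α × β)} (hR : MeasurableSet R) {c : ℝ≥0∞}
    (hc : ∀ ω ∈ E, P {ω' | (X ω, Y ω') ∈ R} ≤ c) :
    P (E ∩ {ω | (X ω, Y ω) ∈ R}) ≤ c * P E := by
  rw [indep_lint hm1 hm2 h hX hY hE hR]
  calc _ ≤ ∫⁻ ω in E, c ∂P := setLIntegral_mono measurable_const hc
    _ = c * P E := by simp

lemma indep_ge [IsProbabilityMeasure P] {α β : Type*} [MeasurableSpace α] [MeasurableSpace β]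
    {m1 m2 : MeasurableSpace Ω} (hm1 : m1 ≤ mΩ) (hm2 : m2 ≤ mΩ) (h : Indep m2 m1 P)
    {X : Ω → α} {Y : Ω → β} (hX : Measurable[m1] X) (hY : Measurable[m2] Y)
    {E : Set Ω} (hE : MeasurableSet[m1] E)
    {R : Set (α × β)} (hR : MeasurableSet R) {c : ℝ≥0∞}
    (hc : ∀ ω ∈ E, c ≤ P {ω' | (X ω, Y ω') ∈ R}) :
    c * P E ≤ P (E ∩ {ω | (X ω, Y ω) ∈ R}) := by
  rw [indep_lint hm1 hm2 h hX hY hE hR]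
  calc c * P E = ∫⁻ ω in E, c ∂P := by simp
    _ ≤ _ := setLIntegral_mono' (hm1 _ hE) hc

variable {B : ℝ → Ω → ℝ}

lemma IsBrownianMotion.law (hB : IsBrownianMotion P B) {t : ℝ} (ht : 0 ≤ t) :
    P.map (B t) = gaussianReal 0 t.toNNReal := by
  have h := hB.incr_law 0 t le_rfl ht
  simp only [sub_zero] at h
  rw [← h]
  apply Measure.map_congr
  filter_upwards [hB.init] with ω hω
  simp [hω]

lemma gaussian_symm (v : ℝ≥0) (z : ℝ) : gaussianReal 0 v (Ici z) = gaussianReal 0 v (Iic (-z)) := by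
  have h : (gaussianReal 0 v).map (fun x => -x) = gaussianReal 0 v := by
    have := gaussianReal_map_neg (μ := 0) (v := v)
    simpa using this
  conv_lhs => rw [← h]
  rw [Measure.map_apply measurable_neg measurableSet_Ici]
  congr 1
  ext x; simp

/-- symmetry of the increment after the past -/
lemma IsBrownianMotion.sym [IsProbabilityMeasure P] (hB : IsBrownianMotion P B) {s t : ℝ}
    (hs : 0 ≤ s) (hst : s ≤ t) {E : Set Ω} (hE : MeasurableSet[natSigma B s] E) (y : ℝ) :
    P (E ∩ {ω | 2 * B s ω - y ≤ B t ω}) = P (E ∩ {ω | B t ω ≤ y}) := by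
  have hind := hB.incr_indep s t hs hst
  have hm1 := natSigma_le_of_meas hB.measurable s
  have hY : Measurable (fun ω => B t ω - B s ω) := (hB.measurable t).sub (hB.measurable s)
  have hX : Measurable[natSigma B s] (B s) := meas_natSigma hs le_rfl
  have k1 := indep_lint hm1 hY.comap_le hind hX (comap_measurable _) hE
    (R := {p : ℝ × ℝ | p.1 - y ≤ p.2}) (measurableSet_le (by fun_prop) (by fun_prop))
  have k2 := indep_lint hm1 hY.comap_le hind hX (comap_measurable _) hE
    (R := {p : ℝ × ℝ | p.2 ≤ -(p.1 - y)}) (measurableSet_le (by fun_prop) (by fun_prop))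
  have e1 : {ω | 2 * B s ω - y ≤ B t ω} = {ω | (B s ω, B t ω - B s ω) ∈ {p : ℝ × ℝ | p.1 - y ≤ p.2}} := by
    ext ω; simp only [mem_ofPred_eq]; constructor <;> intro h <;> linarith
  have e2 : {ω | B t ω ≤ y} = {ω | (B s ω, B t ω - B s ω) ∈ {p : ℝ × ℝ | p.2 ≤ -(p.1 - y)}} := by
    ext ω; simp only [mem_ofPred_eq]; constructor <;> intro h <;> linarith
  rw [e1, e2, k1, k2]
  refine lintegral_congr fun ω => ?_
  have l := hB.incr_law s t hs hst
  have a1 : P {ω' | (B s ω, B t ω' - B s ω') ∈ {p : ℝ × ℝ | p.1 - y ≤ p.2}} =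
      gaussianReal 0 (t - s).toNNReal (Ici (B s ω - y)) := by
    rw [← l, Measure.map_apply hY measurableSet_Ici]; rfl
  have a2 : P {ω' | (B s ω, B t ω' - B s ω') ∈ {p : ℝ × ℝ | p.2 ≤ -(p.1 - y)}} =
      gaussianReal 0 (t - s).toNNReal (Iic (-(B s ω - y))) := by
    rw [← l, Measure.map_apply hY measurableSet_Iic]; rfl
  rw [a1, a2, gaussian_symm]

/-- key discrete reflection identity -/
lemma IsBrownianMotion.refl_key [IsProbabilityMeasure P] (hB : IsBrownianMotion P B) {θ : ℝ}
    (t : ℕ → ℝ) (ht0 : ∀ k, 0 ≤ t k) (htm : Monotone t) (g y : ℝ) (N : ℕ) (htN : ∀ k ≤ N, t k ≤ θ) :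
    P {ω | ∃ k ≤ N, g < B (t k) ω ∧ (∀ j < k, B (t j) ω ≤ g) ∧ 2 * B (t k) ω - y ≤ B θ ω} =
    P {ω | ∃ k ≤ N, g < B (t k) ω ∧ (∀ j < k, B (t j) ω ≤ g) ∧ B θ ω ≤ y} := by
  set A : ℕ → Set Ω := fun k => {ω | g < B (t k) ω ∧ (∀ j < k, B (t j) ω ≤ g)} with hA
  have hAm : ∀ k, MeasurableSet[natSigma B (t k)] (A k) := by
    intro k
    have : A k = {ω | g < B (t k) ω} ∩ ⋂ j, ⋂ (_ : j < k), {ω | B (t j) ω ≤ g} := by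
      ext ω; simp [hA]
    rw [this]
    refine MeasurableSet.inter ?_ (MeasurableSet.iInter fun j => MeasurableSet.iInter fun hj => ?_)
    · exact (meas_natSigma (ht0 k) le_rfl) measurableSet_Ioi
    · exact (meas_natSigma (ht0 j) (htm hj.le)) measurableSet_Iic
  have hdis : ∀ (S : ℕ → Set Ω), Set.PairwiseDisjoint (↑(Finset.range (N+1))) (fun k => A k ∩ S k) := by
    intro S i _ j _ hij
    refine Set.disjoint_left.2 fun ω h1 h2 => ?_
    rcases lt_or_gt_of_ne hij with h | h
    · exact absurd h1.1.1 (not_lt.2 (h2.1.2 i h))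
    · exact absurd h2.1.1 (not_lt.2 (h1.1.2 j h))
  have hm := fun k => natSigma_le_of_meas hB.measurable (t k) _ (hAm k)
  have e1 : {ω | ∃ k ≤ N, g < B (t k) ω ∧ (∀ j < k, B (t j) ω ≤ g) ∧ 2 * B (t k) ω - y ≤ B θ ω} =
      ⋃ k ∈ Finset.range (N+1), A k ∩ {ω | 2 * B (t k) ω - y ≤ B θ ω} := by
    ext ω; simp [hA, and_assoc]; grind
  have e2 : {ω | ∃ k ≤ N, g < B (t k) ω ∧ (∀ j < k, B (t j) ω ≤ g) ∧ B θ ω ≤ y} =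
      ⋃ k ∈ Finset.range (N+1), A k ∩ {ω | B θ ω ≤ y} := by
    ext ω; simp [hA, and_assoc]; grind
  rw [e1, e2, measure_biUnion_finset (hdis _), measure_biUnion_finset (hdis _)]
  · refine Finset.sum_congr rfl fun k hk => hB.sym (ht0 k) (htN k (by simpa [Nat.lt_succ_iff] using hk)) (hAm k) y
  · intro k _
    exact (hm k).inter (measurableSet_le (hB.measurable _) measurable_const)
  · intro k _
    exact (hm k).inter (measurableSet_le (((hB.measurable _).const_mul 2).sub_const y) (hB.measurable _))

end part2

section part3
open scoped NNReal ENNReal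
set_option linter.unusedSectionVars false
variable {Ω : Type*} {mΩ : MeasurableSpace Ω} {P : Measure Ω} {B : ℝ → Ω → ℝ}

lemma measure_le_of_eventually {E : Set Ω} {S : ℕ → Set Ω} {p : ℝ≥0∞} (hp : ∀ n, P (S n) ≤ p)
    (h : ∀ᵐ ω ∂P, ω ∈ E → ∀ᶠ n in atTop, ω ∈ S n) : P E ≤ p := by
  have h1 : P E ≤ P (⋃ n, ⋂ m ≥ n, S m) := by
    apply measure_mono_ae
    filter_upwards [h] with ω hω hE
    obtain ⟨n, hn⟩ := eventually_atTop.1 (hω hE)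
    exact mem_iUnion.2 ⟨n, mem_iInter₂.2 fun m hm => hn m hm⟩
  refine h1.trans ?_
  rw [Directed.measure_iUnion]
  · exact iSup_le fun n => (measure_mono (iInter₂_subset n le_rfl)).trans (hp n)
  · refine (monotone_nat_of_le_succ fun n => ?_).directed_le
    intro ω hω
    exact mem_iInter₂.2 fun m hm => mem_iInter₂.1 hω m (by omega)

lemma grid_tendsto {v θ : ℝ} (h0 : 0 ≤ v) (hθ : 0 < θ) :
    Tendsto (fun N : ℕ => θ * (⌊v / θ * N⌋₊ : ℝ) / N) atTop (𝓝 v) := by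
  have h := (tendsto_nat_floor_mul_div_atTop (R := ℝ) (a := v / θ) (by positivity)).comp
    tendsto_natCast_atTop_atTop
  have h2 := h.const_mul θ
  have e : θ * (v / θ) = v := by field_simp
  rw [e] at h2
  refine h2.congr fun N => ?_
  simp [mul_div_assoc]

/-- The event of crossing the level `g` before time `θ`. -/
def crossSet (B : ℝ → Ω → ℝ) (θ g : ℝ) : Set Ω := {ω | ∃ v, 0 ≤ v ∧ v ≤ θ ∧ g < B v ω}

lemma IsBrownianMotion.refl_le [IsProbabilityMeasure P] (hB : IsBrownianMotion P B) {θ : ℝ}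
    (hθ : 0 < θ) (g y : ℝ) :
    P (crossSet B θ g ∩ {ω | B θ ω ≤ y}) ≤ P {ω | 2 * g - y ≤ B θ ω} := by
  refine measure_le_of_eventually (S := fun N => {ω | ∃ k ≤ N, g < B (θ * k / N) ω ∧
    (∀ j < k, B (θ * j / N) ω ≤ g) ∧ B θ ω ≤ y}) ?_ ?_
  · intro N
    rw [← hB.refl_key (fun k => θ * k / N) (fun k => by positivity) ?_ g y N ?_]
    · apply measure_mono
      rintro ω ⟨k, hk, h1, h2, h3⟩
      show 2 * g - y ≤ B θ ω
      linarith
    · intro a b hab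
      show θ * a / N ≤ θ * b / N
      gcongr
    · intro k hk
      rcases Nat.eq_zero_or_pos N with rfl | hN
      · simp [hθ.le]
      · rw [div_le_iff₀ (by positivity)]
        gcongr
  · filter_upwards [hB.cont] with ω hc ⟨⟨v, h0, hv, hg⟩, hy⟩
    have ht := grid_tendsto h0 hθ
    have hcv : Tendsto (fun x => B x ω) (𝓝[Ici 0] v) (𝓝 (B v ω)) := hc v h0
    have ht' : Tendsto (fun N : ℕ => θ * (⌊v / θ * N⌋₊ : ℝ) / N) atTop (𝓝[Ici 0] v) := by
      refine tendsto_nhdsWithin_iff.2 ⟨ht, Eventually.of_forall fun N => ?_⟩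
      simp only [mem_Ici]; positivity
    have := (hcv.comp ht').eventually (lt_mem_nhds hg)
    filter_upwards [this] with N hN
    have hle : ⌊v / θ * N⌋₊ ≤ N := by
      apply Nat.floor_le_of_le
      have : v / θ ≤ 1 := by rw [div_le_one hθ]; exact hv
      nlinarith [Nat.cast_nonneg (α := ℝ) N]
    have hex : ∃ k : ℕ, k ≤ N ∧ g < B (θ * k / N) ω := ⟨_, hle, hN⟩
    classical
    refine ⟨Nat.find hex, (Nat.find_spec hex).1, (Nat.find_spec hex).2, fun j hj => ?_, hy⟩
    have := Nat.find_min hex hj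
    by_contra hcon
    exact this ⟨(hj.le.trans (Nat.find_spec hex).1), not_le.1 hcon⟩

lemma IsBrownianMotion.refl_ge [IsProbabilityMeasure P] (hB : IsBrownianMotion P B) {θ : ℝ}
    (hθ : 0 < θ) {g y : ℝ} (hg : 0 ≤ g) (hy : y ≤ g) :
    P {ω | 2 * g - y < B θ ω} ≤ P (crossSet B θ g ∩ {ω | B θ ω ≤ y}) := by
  refine measure_le_of_eventually (S := fun N => {ω | ∃ k ≤ N, g < B (θ * k / N) ω ∧
    (∀ j < k, B (θ * j / N) ω ≤ g) ∧ 2 * B (θ * k / N) ω - y ≤ B θ ω}) ?_ ?_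
  · intro N
    rw [hB.refl_key (fun k => θ * k / N) (fun k => by positivity) ?_ g y N ?_]
    · apply measure_mono
      rintro ω ⟨k, hk, h1, h2, h3⟩
      refine ⟨⟨θ * k / N, by positivity, ?_, h1⟩, h3⟩
      rcases Nat.eq_zero_or_pos N with rfl | hN
      · simp [hθ.le]
      · rw [div_le_iff₀ (by positivity)]
        gcongr
    · intro a b hab
      show θ * a / N ≤ θ * b / N
      gcongr
    · intro k hk
      rcases Nat.eq_zero_or_pos N with rfl | hN
      · simp [hθ.le]
      · rw [div_le_iff₀ (by positivity)]
        gcongr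
  · filter_upwards [hB.cont, hB.init] with ω hc hi hlt
    have hlt : 2 * g - y < B θ ω := hlt
    have huc : UniformContinuousOn (fun t => B t ω) (Icc 0 θ) :=
      isCompact_Icc.uniformContinuousOn_of_continuous (hc.mono Icc_subset_Ici_self)
    rw [Metric.uniformContinuousOn_iff] at huc
    obtain ⟨d, hd, hd'⟩ := huc ((B θ ω - (2 * g - y)) / 2) (by linarith)
    have hNd : ∀ᶠ N : ℕ in atTop, θ / N < d := by
      have := tendsto_const_div_atTop_nhds_zero_nat θ
      exact this.eventually (gt_mem_nhds hd)
    filter_upwards [hNd, eventually_gt_atTop 0] with N hN hN0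
    have hNr : (0:ℝ) < N := by exact_mod_cast hN0
    have hex : ∃ k : ℕ, k ≤ N ∧ g < B (θ * k / N) ω := by
      refine ⟨N, le_rfl, ?_⟩
      rw [mul_div_assoc, div_self hNr.ne', mul_one]; linarith
    classical
    have hs := Nat.find_spec hex
    refine ⟨Nat.find hex, hs.1, hs.2, fun j hj => ?_, ?_⟩
    · have := Nat.find_min hex hj
      by_contra hcon
      exact this ⟨(hj.le.trans hs.1), not_le.1 hcon⟩
    · set k := Nat.find hex with hk
      have hk0 : k ≠ 0 := by
        intro h0
        rw [h0] at hs
        simp [hi] at hs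
        linarith
      obtain ⟨m, hm⟩ := Nat.exists_eq_succ_of_ne_zero hk0
      have hmg : B (θ * m / N) ω ≤ g := by
        have := Nat.find_min hex (show m < Nat.find hex by omega)
        by_contra hcon
        exact this ⟨by omega, not_le.1 hcon⟩
      have hin : ∀ j : ℕ, j ≤ N → θ * j / N ∈ Icc 0 θ := by
        intro j hj
        refine ⟨by positivity, ?_⟩
        rw [div_le_iff₀ hNr]
        gcongr
      have := hd' (θ * k / N) (hin k hs.1) (θ * m / N) (hin m (by omega)) (by
        rw [Real.dist_eq, hm]
        push_cast
        rw [show θ * ((m:ℝ) + 1) / N - θ * m / N = θ / N by ring, abs_of_pos (by positivity)]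
        exact hN)
      rw [Real.dist_eq] at this
      have := (abs_lt.1 this).2
      linarith

end part3

section part4
open scoped NNReal ENNReal
set_option linter.unusedSectionVars false
variable {Ω : Type*} {mΩ : MeasurableSpace Ω} {P : Measure Ω} {B : ℝ → Ω → ℝ}

/-- stay below the line `g + b v` on rational times of `[0, θ]` -/
def staySet (B : ℝ → Ω → ℝ) (θ g b : ℝ) : Set Ω :=
  {ω | ∀ q : ℚ, 0 ≤ (q : ℝ) → (q : ℝ) ≤ θ → B q ω ≤ g + b * q}

/-- stay below the line `g + b v` on all nonnegative rational times -/
def stayInf (B : ℝ → Ω → ℝ) (g b : ℝ) : Set Ω :=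
  {ω | ∀ q : ℚ, 0 ≤ (q : ℝ) → B q ω ≤ g + b * q}

lemma measurableSet_staySet' {m : MeasurableSpace Ω} {θ g b : ℝ}
    (h : ∀ q, 0 ≤ q → q ≤ θ → Measurable[m] (B q)) : MeasurableSet[m] (staySet B θ g b) := by
  have : staySet B θ g b = ⋂ q : ℚ, ⋂ (_ : 0 ≤ (q:ℝ)), ⋂ (_ : (q:ℝ) ≤ θ), {ω | B q ω ≤ g + b * q} := by
    ext ω; simp [staySet]
  rw [this]
  exact MeasurableSet.iInter fun q => MeasurableSet.iInter fun h0 => MeasurableSet.iInter fun h1 =>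
    (h q h0 h1) measurableSet_Iic

lemma measurableSet_stayInf' {m : MeasurableSpace Ω} {g b : ℝ}
    (h : ∀ q, 0 ≤ q → Measurable[m] (B q)) : MeasurableSet[m] (stayInf B g b) := by
  have : stayInf B g b = ⋂ q : ℚ, ⋂ (_ : 0 ≤ (q:ℝ)), {ω | B q ω ≤ g + b * q} := by
    ext ω; simp [stayInf]
  rw [this]
  exact MeasurableSet.iInter fun q => MeasurableSet.iInter fun h0 => (h q h0) measurableSet_Iic

lemma rat_to_real {f l : ℝ → ℝ} {a θ : ℝ} (hf : ContinuousOn f (Icc a θ)) (hl : Continuous l) (hθ : a < θ)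
    (h : ∀ q : ℚ, a ≤ (q:ℝ) → (q:ℝ) ≤ θ → f q ≤ l q) : ∀ v, a ≤ v → v ≤ θ → f v ≤ l v := by
  intro v h0 hv
  have hd : Dense (range ((↑) : ℚ → ℝ)) := Rat.denseRange_cast
  have h1 := hd.open_subset_closure_inter (isOpen_Ioo (a := a) (b := θ))
  have h2 : Icc a θ ⊆ closure (Ioo a θ ∩ range ((↑) : ℚ → ℝ)) := by
    rw [← closure_Ioo hθ.ne]
    exact closure_minimal h1 isClosed_closure
  have h3 : closure (Ioo a θ ∩ range ((↑) : ℚ → ℝ)) ⊆ Icc a θ := by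
    rw [← closure_Ioo hθ.ne]
    exact closure_mono inter_subset_left
  refine le_on_closure (s := Ioo a θ ∩ range ((↑) : ℚ → ℝ)) ?_ (hf.mono h3) hl.continuousOn (h2 ⟨h0, hv⟩)
  rintro x ⟨hx, q, rfl⟩
  exact h q hx.1.le hx.2.le

lemma stay_real {θ g b : ℝ} {ω : Ω} (hc : ContinuousOn (fun t => B t ω) (Ici 0)) (hθ : 0 < θ)
    (h : ω ∈ staySet B θ g b) {v : ℝ} (h0 : 0 ≤ v) (hv : v ≤ θ) : B v ω ≤ g + b * v :=
  rat_to_real (f := fun t => B t ω) (l := fun v => g + b * v)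
    (hc.mono Icc_subset_Ici_self) (by fun_prop) hθ h v h0 hv

lemma stayInf_real {g b : ℝ} {ω : Ω} (hc : ContinuousOn (fun t => B t ω) (Ici 0))
    (h : ω ∈ stayInf B g b) {v : ℝ} (h0 : 0 ≤ v) : B v ω ≤ g + b * v :=
  stay_real (θ := v + 1) hc (by linarith) (fun q hq _ => h q hq) h0 (by linarith)

lemma gaussian_reflect (v : ℝ≥0) (g y1 y2 : ℝ) :
    gaussianReal 0 v (Ico (2 * g - y2) (2 * g - y1)) = gaussianReal (2 * g) v (Ioc y1 y2) := by
  have h1 : (gaussianReal 0 v).map (fun x => 2 * g - x) = gaussianReal (2 * g) v := by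
    have := gaussianReal_map_const_sub (μ := 0) (v := v) (2 * g)
    simpa using this
  rw [← h1, Measure.map_apply (by fun_prop) measurableSet_Ioc]
  congr 1
  ext x; simp only [mem_Ico, mem_preimage, mem_Ioc]; constructor <;> rintro ⟨a, b⟩ <;> constructor <;> linarith

lemma pdf_shift {v : ℝ≥0} (hv : v ≠ 0) (g z : ℝ) :
    gaussianPDFReal (2 * g) v z = Real.exp (-(2 * g * (g - z) / v)) * gaussianPDFReal 0 v z := by
  have hv' : (v:ℝ) ≠ 0 := by exact_mod_cast hv
  simp only [gaussianPDFReal]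
  rw [mul_left_comm, ← Real.exp_add]
  congr 2
  field_simp
  ring

lemma gaussian_reflect_le {v : ℝ≥0} (hv : v ≠ 0) {g y1 y2 : ℝ} (hg : 0 ≤ g) :
    gaussianReal (2 * g) v (Ioc y1 y2) ≤
      ENNReal.ofReal (Real.exp (-(2 * g * (g - y2) / v))) * gaussianReal 0 v (Ioc y1 y2) := by
  rw [gaussianReal_apply _ hv, gaussianReal_apply _ hv, ← lintegral_const_mul _ (by fun_prop)]
  refine setLIntegral_mono (by fun_prop) fun z hz => ?_
  rw [gaussianPDF, gaussianPDF, ← ENNReal.ofReal_mul (Real.exp_nonneg _), pdf_shift hv]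
  apply ENNReal.ofReal_le_ofReal
  have := gaussianPDFReal_nonneg 0 v z
  have := hz.2
  gcongr

lemma gaussian_reflect_ge {v : ℝ≥0} (hv : v ≠ 0) {g y1 y2 : ℝ} (hg : 0 ≤ g) :
    ENNReal.ofReal (1 - 2 * g * (g - y1) / v) * gaussianReal 0 v (Ioc y1 y2) ≤
      gaussianReal (2 * g) v (Ioc y1 y2)  := by
  rw [gaussianReal_apply _ hv, gaussianReal_apply _ hv, ← lintegral_const_mul _ (by fun_prop)]
  refine setLIntegral_mono (by fun_prop) fun z hz => ?_
  rw [gaussianPDF, gaussianPDF]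
  rcases le_or_gt (1 - 2 * g * (g - y1) / v) 0 with h0 | h0
  · rw [ENNReal.ofReal_of_nonpos h0]; simp
  rw [← ENNReal.ofReal_mul h0.le, pdf_shift hv]
  apply ENNReal.ofReal_le_ofReal
  have := gaussianPDFReal_nonneg 0 v z
  have h1 := hz.1
  have h2 := Real.add_one_le_exp (-(2 * g * (g - z) / v))
  have h3 : 2 * g * (g - z) / v ≤ 2 * g * (g - y1) / v := by gcongr
  gcongr
  linarith

/-- staying below a level and ending below `y`. -/
lemma IsBrownianMotion.stay_Iic [IsProbabilityMeasure P] (hB : IsBrownianMotion P B) {θ : ℝ}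
    (hθ : 0 < θ) {g y : ℝ} (hg : 0 ≤ g) (hy : y ≤ g) :
    P.real (staySet B θ g 0 ∩ {ω | B θ ω ≤ y}) + (gaussianReal 0 θ.toNNReal).real (Ici (2 * g - y))
      = (gaussianReal 0 θ.toNNReal).real (Iic y) := by
  have hv : θ.toNNReal ≠ 0 := by simpa using hθ
  have hl := hB.law hθ.le
  have hm : MeasurableSet (staySet B θ g 0) := measurableSet_staySet' fun q _ _ => hB.measurable q
  have hmy : MeasurableSet {ω | B θ ω ≤ y} := measurableSet_le (hB.measurable _) measurable_const
  have e1 : (gaussianReal 0 θ.toNNReal) (Iic y) = P {ω | B θ ω ≤ y} := by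
    rw [← hl, Measure.map_apply (hB.measurable _) measurableSet_Iic]; rfl
  have e2 : (gaussianReal 0 θ.toNNReal) (Ici (2 * g - y)) = P {ω | 2 * g - y ≤ B θ ω} := by
    rw [← hl, Measure.map_apply (hB.measurable _) measurableSet_Ici]; rfl
  have e3 : (gaussianReal 0 θ.toNNReal) (Ioi (2 * g - y)) = P {ω | 2 * g - y < B θ ω} := by
    rw [← hl, Measure.map_apply (hB.measurable _) measurableSet_Ioi]; rfl
  have : NullSingletonClass (gaussianReal 0 θ.toNNReal) := nullSingletonClass_gaussianReal hv
  have e4 : P (crossSet B θ g ∩ {ω | B θ ω ≤ y}) = gaussianReal 0 θ.toNNReal (Ici (2 * g - y)) := by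
    apply le_antisymm
    · rw [e2]; exact hB.refl_le hθ g y
    · rw [measure_congr (Ioi_ae_eq_Ici (a := 2 * g - y)).symm, e3]
      exact hB.refl_ge hθ hg hy
  have e5 : P ({ω | B θ ω ≤ y} \ staySet B θ g 0) = P (crossSet B θ g ∩ {ω | B θ ω ≤ y}) := by
    apply measure_congr
    filter_upwards [hB.cont] with ω hc
    apply propext
    show (ω ∈ {ω | B θ ω ≤ y} ∧ ¬ ω ∈ staySet B θ g 0) ↔ (ω ∈ crossSet B θ g ∧ ω ∈ {ω | B θ ω ≤ y})
    rw [and_comm]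
    refine and_congr_left fun _ => ?_
    constructor
    · intro h
      simp only [staySet, mem_ofPred_eq, not_forall, not_le] at h
      obtain ⟨q, h0, h1, h2⟩ := h
      exact ⟨q, h0, h1, by simpa using h2⟩
    · rintro ⟨v, h0, h1, h2⟩ hst
      have := stay_real hc hθ hst h0 h1
      linarith
  have e6 := measure_inter_add_sdiff (μ := P) {ω | B θ ω ≤ y} hm
  rw [e5, e4, ← e1, inter_comm] at e6
  simp only [Measure.real]
  rw [← e6, ENNReal.toReal_add (measure_ne_top _ _) (measure_ne_top _ _)]

lemma IsBrownianMotion.stay_window [IsProbabilityMeasure P] (hB : IsBrownianMotion P B) {θ : ℝ}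
    (hθ : 0 < θ) {g y1 y2 : ℝ} (hg : 0 ≤ g) (hy : y1 ≤ y2) (hy2 : y2 ≤ g) :
    P.real (staySet B θ g 0 ∩ {ω | B θ ω ∈ Ioc y1 y2}) =
      (gaussianReal 0 θ.toNNReal).real (Ioc y1 y2) - (gaussianReal (2 * g) θ.toNNReal).real (Ioc y1 y2) := by
  have h1 := hB.stay_Iic hθ hg hy2
  have h2 := hB.stay_Iic hθ hg (hy.trans hy2)
  have hm : MeasurableSet (staySet B θ g 0) := measurableSet_staySet' fun q _ _ => hB.measurable q
  have e1 : staySet B θ g 0 ∩ {ω | B θ ω ≤ y2} = (staySet B θ g 0 ∩ {ω | B θ ω ≤ y1}) ∪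
      (staySet B θ g 0 ∩ {ω | B θ ω ∈ Ioc y1 y2}) := by
    ext ω; simp only [mem_inter_iff, mem_ofPred_eq, mem_union, mem_Ioc]; grind
  have e2 : Iic y2 = Iic y1 ∪ Ioc y1 y2 := (Iic_union_Ioc_eq_Iic hy).symm
  have e3 : Ici (2 * g - y2) = Ico (2 * g - y2) (2 * g - y1) ∪ Ici (2 * g - y1) :=
    (Ico_union_Ici_eq_Ici (by linarith)).symm
  rw [e1, measureReal_union ?_ ?_, e2, measureReal_union ?_ measurableSet_Ioc, e3,
    measureReal_union ?_ measurableSet_Ici] at h1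
  · have : (gaussianReal 0 θ.toNNReal).real (Ico (2 * g - y2) (2 * g - y1)) =
      (gaussianReal (2 * g) θ.toNNReal).real (Ioc y1 y2) := by
      simp only [Measure.real, gaussian_reflect]
    linarith
  · exact disjoint_left.2 fun x h1 h2 => by simp at h1 h2; linarith [h1.2]
  · exact disjoint_left.2 fun x h1 h2 => by simp at h1 h2; linarith [h2.1]
  · exact disjoint_left.2 fun x h1 h2 => by
      have a := h1.2; have b := h2.2.1; simp at a; linarith
  · exact hm.inter ((hB.measurable _) measurableSet_Ioc)

lemma IsBrownianMotion.stay_window_le [IsProbabilityMeasure P] (hB : IsBrownianMotion P B) {θ : ℝ}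
    (hθ : 0 < θ) {g y1 y2 : ℝ} (hg : 0 ≤ g) (hy : y1 ≤ y2) (hy2 : y2 ≤ g) :
    P.real (staySet B θ g 0 ∩ {ω | B θ ω ∈ Ioc y1 y2}) ≤
      (2 * g * (g - y1) / θ) * (gaussianReal 0 θ.toNNReal).real (Ioc y1 y2) := by
  have hv : θ.toNNReal ≠ 0 := by simpa using hθ
  rw [hB.stay_window hθ hg hy hy2]
  have := ENNReal.toReal_mono (measure_ne_top _ _) (gaussian_reflect_ge hv (y1 := y1) (y2 := y2) hg)
  rw [ENNReal.toReal_mul] at this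
  have h2 : (1 - 2 * g * (g - y1) / θ) ≤ (ENNReal.ofReal (1 - 2 * g * (g - y1) / θ.toNNReal)).toReal := by
    rw [ENNReal.toReal_ofReal', Real.coe_toNNReal _ hθ.le]; exact le_max_left _ _
  have h3 := mul_le_mul_of_nonneg_right h2 (measureReal_nonneg (μ := gaussianReal 0 θ.toNNReal) (s := Ioc y1 y2))
  simp only [Measure.real] at *
  nlinarith

lemma IsBrownianMotion.stay_window_ge [IsProbabilityMeasure P] (hB : IsBrownianMotion P B) {θ : ℝ}
    (hθ : 0 < θ) {g y1 y2 : ℝ} (hg : 0 ≤ g) (hy : y1 ≤ y2) (hy2 : y2 ≤ g) :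
    (1 - Real.exp (-(2 * g * (g - y2) / θ))) * (gaussianReal 0 θ.toNNReal).real (Ioc y1 y2) ≤
    P.real (staySet B θ g 0 ∩ {ω | B θ ω ∈ Ioc y1 y2}) := by
  have hv : θ.toNNReal ≠ 0 := by simpa using hθ
  rw [hB.stay_window hθ hg hy hy2]
  have := ENNReal.toReal_mono (by finiteness) (gaussian_reflect_le hv (y1 := y1) (y2 := y2) hg)
  rw [ENNReal.toReal_mul, ENNReal.toReal_ofReal (Real.exp_nonneg _), Real.coe_toNNReal _ hθ.le] at this
  simp only [Measure.real] at *
  nlinarith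

end part4

section part5
open scoped NNReal ENNReal
set_option linter.unusedSectionVars false
variable {Ω : Type*} {mΩ : MeasurableSpace Ω} {P : Measure Ω} {B : ℝ → Ω → ℝ}

lemma gauss_le {v : ℝ≥0} (hv : v ≠ 0) {S : Set ℝ} (hS : MeasurableSet S) {M : ℝ}
    (h : ∀ z ∈ S, gaussianPDFReal 0 v z ≤ M) :
    gaussianReal 0 v S ≤ ENNReal.ofReal M * volume S := by
  rw [gaussianReal_apply _ hv]
  calc _ ≤ ∫⁻ _ in S, ENNReal.ofReal M := setLIntegral_mono' hS fun z hz => ENNReal.ofReal_le_ofReal (h z hz)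
    _ = _ := by simp

lemma gauss_ge {v : ℝ≥0} (hv : v ≠ 0) {S : Set ℝ} (hS : MeasurableSet S) {M : ℝ}
    (h : ∀ z ∈ S, M ≤ gaussianPDFReal 0 v z) :
    ENNReal.ofReal M * volume S ≤ gaussianReal 0 v S := by
  rw [gaussianReal_apply _ hv]
  calc _ = ∫⁻ _ in S, ENNReal.ofReal M := by simp
    _ ≤ _ := setLIntegral_mono' hS fun z hz => ENNReal.ofReal_le_ofReal (h z hz)

lemma pdf_ge {v : ℝ≥0} {z R : ℝ} (hz : |z| ≤ R) : gaussianPDFReal 0 v R ≤ gaussianPDFReal 0 v z := by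
  simp only [gaussianPDFReal, sub_zero]
  have : z ^ 2 ≤ R ^ 2 := sq_le_sq' (by linarith [abs_le.1 hz]) (abs_le.1 hz).2
  gcongr

lemma pdf_anti {v : ℝ≥0} {z r : ℝ} (h0 : 0 ≤ r) (hz : r ≤ |z|) : gaussianPDFReal 0 v z ≤ gaussianPDFReal 0 v r := by
  simp only [gaussianPDFReal, sub_zero]
  have : r ^ 2 ≤ z ^ 2 := by rw [← sq_abs z]; gcongr
  gcongr

lemma gauss_Ioc_ge {v : ℝ≥0} (hv : v ≠ 0) {a b R : ℝ} (h1 : -R ≤ a) (h2 : b ≤ R) :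
    gaussianPDFReal 0 v R * (b - a) ≤ (gaussianReal 0 v).real (Ioc a b) := by
  have := gauss_ge hv (S := Ioc a b) measurableSet_Ioc (M := gaussianPDFReal 0 v R)
    fun z hz => pdf_ge (abs_le.2 ⟨by linarith [hz.1], by linarith [hz.2]⟩)
  rw [Real.volume_Ioc, ← ENNReal.ofReal_mul (gaussianPDFReal_nonneg _ _ _)] at this
  exact (ENNReal.ofReal_le_iff_le_toReal (measure_ne_top _ _)).1 this

lemma gauss_Ioc_pos {v : ℝ≥0} (hv : v ≠ 0) {a b : ℝ} (h : a < b) :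
    0 < (gaussianReal 0 v).real (Ioc a b) := by
  have := gauss_Ioc_ge hv (a := a) (b := b) (R := |a| + |b|) (by linarith [neg_abs_le a, abs_nonneg b])
    (by linarith [le_abs_self b, abs_nonneg a])
  have h2 := gaussianPDFReal_pos 0 v (|a| + |b|) hv
  have h3 : 0 < b - a := by linarith
  nlinarith [mul_pos h2 h3]

lemma IsBrownianMotion.cheb [IsProbabilityMeasure P] (hB : IsBrownianMotion P B) {t c : ℝ}
    (ht : 0 ≤ t) (hc : 0 < c) : P.real {ω | c ≤ |B t ω|} ≤ t / c ^ 2 := by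
  have hl := hB.law ht
  have h2 : MemLp (B t) 2 P := by
    have := hB.pre
    exact (this.isGaussianProcess.hasGaussianLaw_eval ⟨t, ht⟩).memLp_two
  have hE : ∫ ω, B t ω ∂P = 0 := by
    have := integral_map (μ := P) (φ := B t) (hB.measurable t).aemeasurable (f := fun x => x) (by fun_prop)
    rw [← this, hl, integral_id_gaussianReal]
  have hV : Var[B t; P] = t := by
    have := variance_map (μ := P) (Y := B t) (X := id) (by fun_prop) (hB.measurable t).aemeasurable
    rw [Function.id_comp] at this
    rw [← this, hl, variance_id_gaussianReal]; simp [ht]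
  have := meas_ge_le_variance_div_sq h2 hc
  rw [hE, hV] at this
  simp only [sub_zero] at this
  exact ENNReal.toReal_le_of_le_ofReal (by positivity) this

/-- version of `indep_lin` with real parameters -/
lemma IsBrownianMotion.indep_linR [IsProbabilityMeasure P] (hB : IsBrownianMotion P B)
    {ι : Type*} {a b c : ℝ} (ha : 0 ≤ a) (hb : 0 ≤ b) (hc : 0 ≤ c) (α β γ : ℝ) (τ : ι → ℝ) (hτ : ∀ i, 0 ≤ τ i)
    (κ : ι → ℝ) (V : ℝ)
    (hV : V = α * (α * min a a + β * min a b + γ * min a c) +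
      β * (α * min b a + β * min b b + γ * min b c) +
      γ * (α * min c a + β * min c b + γ * min c c))
    (hcov : ∀ i, α * min a (τ i) + β * min b (τ i) + γ * min c (τ i) = κ i * V) :
    IndepFun (fun ω => α * B a ω + β * B b ω + γ * B c ω)
      (fun ω i => B (τ i) ω - κ i * (α * B a ω + β * B b ω + γ * B c ω)) P ∧
    P.map (fun ω => α * B a ω + β * B b ω + γ * B c ω) = gaussianReal 0 V.toNNReal := by
  lift a to ℝ≥0 using ha
  lift b to ℝ≥0 using hb
  lift c to ℝ≥0 using hc
  lift τ to ι → ℝ≥0 using hτ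
  exact hB.indep_lin a b c α β γ τ κ V (by push_cast; exact hV) (by push_cast; exact hcov)

/-- the bridge of `B` over `[0,θ]` stays below the chord from `g` to `h` -/
def bridgeSet (B : ℝ → Ω → ℝ) (θ g h : ℝ) : Set Ω :=
  {ω | ∀ q : ℚ, 0 ≤ (q : ℝ) → (q : ℝ) ≤ θ → B q ω - q / θ * B θ ω ≤ g + (h - g) * (q / θ)}

lemma IsBrownianMotion.bridge_prod [IsProbabilityMeasure P] (hB : IsBrownianMotion P B) {θ : ℝ}
    (hθ : 0 < θ) (g h : ℝ) {J : Set ℝ} (hJ : MeasurableSet J) :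
    P.real (bridgeSet B θ g h ∩ {ω | B θ ω ∈ J}) = P.real (bridgeSet B θ g h) * (gaussianReal 0 θ.toNNReal).real J := by
  let ι := {q : ℚ // 0 ≤ (q:ℝ) ∧ (q:ℝ) ≤ θ}
  have key := (hB.indep_linR (ι := ι) (a := θ) (b := 0) (c := 0) hθ.le le_rfl le_rfl 1 0 0 (fun i => i.1) (fun i => i.2.1)
    (fun i => i.1 / θ) θ (by simp) (by
      intro i
      have : min θ (i.1 : ℝ) = i.1 := min_eq_right i.2.2
      rw [this]; field_simp; simp)).1
  simp only [one_mul, zero_mul, add_zero] at key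
  have hS : MeasurableSet {f : ι → ℝ | ∀ i, f i ≤ g + (h - g) * (i.1 / θ)} := by
    have : {f : ι → ℝ | ∀ i, f i ≤ g + (h - g) * (i.1 / θ)} = ⋂ i, {f | f i ≤ g + (h - g) * (i.1 / θ)} := by
      ext; simp
    rw [this]
    exact MeasurableSet.iInter fun i => measurableSet_le (measurable_pi_apply i) measurable_const
  have k2 := key.measure_inter_preimage_eq_mul J _ hJ hS
  have e1 : (fun ω (i : ι) => B i.1 ω - i.1 / θ * B θ ω) ⁻¹' {f : ι → ℝ | ∀ i, f i ≤ g + (h - g) * (i.1 / θ)}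
      = bridgeSet B θ g h := by
    ext ω; simp [bridgeSet, ι]
  have e2 : P (B θ ⁻¹' J) = gaussianReal 0 θ.toNNReal J := by
    rw [← hB.law hθ.le, Measure.map_apply (hB.measurable θ) hJ]
  have k3 : P (B θ ⁻¹' J ∩ bridgeSet B θ g h) = P (B θ ⁻¹' J) * P (bridgeSet B θ g h) := by
    rw [← e1]; exact k2
  rw [inter_comm, mul_comm]
  simp only [Measure.real]
  rw [← e2, ← ENNReal.toReal_mul, ← k3]; rfl

lemma IsBrownianMotion.bridge_le [IsProbabilityMeasure P] (hB : IsBrownianMotion P B) {θ g h : ℝ}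
    (hθ : 0 < θ) (hg : 0 < g) (hh : 0 < h) : P.real (bridgeSet B θ g h) ≤ 4 * g * h / θ := by
  have hv : θ.toNNReal ≠ 0 := by simpa using hθ
  have h1 := hB.bridge_prod hθ g h (J := Ioc (g - 2 * h) (g - h)) measurableSet_Ioc
  have h2 := hB.stay_window_le hθ hg.le (y1 := g - 2 * h) (y2 := g - h) (by linarith) (by linarith)
  have h3 : P.real (bridgeSet B θ g h ∩ {ω | B θ ω ∈ Ioc (g - 2 * h) (g - h)}) ≤
    P.real (staySet B θ g 0 ∩ {ω | B θ ω ∈ Ioc (g - 2 * h) (g - h)}) := by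
    apply measureReal_mono _ (measure_ne_top _ _)
    rintro ω ⟨ha, hb⟩
    refine ⟨fun q q0 q1 => ?_, hb⟩
    have a1 := ha q q0 q1
    have a2 : B θ ω ≤ g - h := hb.2
    have a3 : 0 ≤ (q:ℝ) / θ := by positivity
    nlinarith [mul_le_mul_of_nonneg_left a2 a3]
  have h4 := gauss_Ioc_pos hv (a := g - 2 * h) (b := g - h) (by linarith)
  rw [h1] at h3
  have h5 := h3.trans h2
  have h6 := le_of_mul_le_mul_right h5 h4
  refine h6.trans (le_of_eq ?_); ring

lemma IsBrownianMotion.bridge_ge [IsProbabilityMeasure P] (hB : IsBrownianMotion P B) {θ g h : ℝ}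
    (hθ : 0 < θ) (hg : 0 < g) (hh : 0 < h) : 1 - Real.exp (-(g * h / θ)) ≤ P.real (bridgeSet B θ g h) := by
  have hv : θ.toNNReal ≠ 0 := by simpa using hθ
  have h1 := hB.bridge_prod hθ g h (J := Ioc (g - h) (g - h / 2)) measurableSet_Ioc
  have h2 := hB.stay_window_ge hθ hg.le (y1 := g - h) (y2 := g - h / 2) (by linarith) (by linarith)
  have h3 : P.real (staySet B θ g 0 ∩ {ω | B θ ω ∈ Ioc (g - h) (g - h / 2)}) ≤
    P.real (bridgeSet B θ g h ∩ {ω | B θ ω ∈ Ioc (g - h) (g - h / 2)}) := by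
    apply measureReal_mono _ (measure_ne_top _ _)
    rintro ω ⟨ha, hb⟩
    refine ⟨fun q q0 q1 => ?_, hb⟩
    have a1 := ha q q0 q1
    have a2 : g - h < B θ ω := hb.1
    have a3 : 0 ≤ (q:ℝ) / θ := by positivity
    nlinarith [mul_le_mul_of_nonneg_left a2.le a3]
  have h4 := gauss_Ioc_pos hv (a := g - h) (b := g - h / 2) (by linarith)
  rw [h1] at h3
  have h5 := h2.trans h3
  have h6 := le_of_mul_le_mul_right h5 h4
  refine (le_of_eq ?_).trans h6
  congr 3; ring

lemma IsBrownianMotion.q_le0 [IsProbabilityMeasure P] (hB : IsBrownianMotion P B) {g b : ℝ}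
    (hg : 0 < g) (hb : 0 < b) : P.real (stayInf B g b) ≤ 4 * g * b := by
  have main : ∀ η > 0, ∀ N : ℕ, P.real (stayInf B g b) ≤
      1 / η ^ 2 * (1 / ((N:ℝ) + 1)) + (4 * g ^ 2 * (1 / ((N:ℝ) + 1)) + 4 * g * (b + η)) := by
    intro η hη N
    set M : ℝ := (N:ℝ) + 1
    have hM : 0 < M := by positivity
    have h1 := hB.cheb hM.le (c := η * M) (by positivity)
    have h2 := hB.bridge_le (θ := M) (g := g) (h := g + (b + η) * M) hM hg (by positivity)
    calc P.real (stayInf B g b) ≤ P.real ({ω | η * M ≤ |B M ω|} ∪ bridgeSet B M g (g + (b + η) * M)) := by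
          apply measureReal_mono _ (measure_ne_top _ _)
          intro ω hω
          by_cases hc : η * M ≤ |B M ω|
          · exact Or.inl hc
          right
          intro q q0 q1
          have a1 := hω q q0
          have a2 := (abs_lt.1 (not_le.1 hc)).1
          have a3 : 0 ≤ (q:ℝ) / M := by positivity
          have a4 : (q:ℝ) / M * M = q := by field_simp
          have a5 := mul_le_mul_of_nonneg_left a2.le a3
          have e : (g + (b + η) * M - g) * (q / M) = b * (q / M * M) + q / M * (η * M) := by ring
          rw [e, a4]; linarith
      _ ≤ _ := measureReal_union_le _ _
      _ ≤ _ := add_le_add h1 h2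
      _ = _ := by field_simp
  have l1 := tendsto_one_div_add_atTop_nhds_zero_nat (𝕜 := ℝ)
  have m2 : ∀ η > 0, P.real (stayInf B g b) ≤ 4 * g * (b + η) := by
    intro η hη
    have l2 := ((l1.const_mul (1 / η ^ 2)).add ((l1.const_mul (4 * g ^ 2)).add_const (4 * g * (b + η))))
    have := ge_of_tendsto' l2 (main η hη)
    simpa using this
  refine le_of_forall_pos_le_add fun e he => ?_
  have := m2 (e / (4 * g)) (by positivity)
  have e2 : 4 * g * (b + e / (4 * g)) = 4 * g * b + e := by field_simp
  linarith

lemma stayInf_mono {g g' b b' : ℝ} (h1 : g ≤ g') (h2 : b ≤ b') : stayInf B g b ⊆ stayInf B g' b' := by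
  intro ω hω q q0
  have := hω q q0
  nlinarith [mul_le_mul_of_nonneg_right h2 q0]

lemma IsBrownianMotion.q_le [IsProbabilityMeasure P] (hB : IsBrownianMotion P B) (g b : ℝ) :
    P.real (stayInf B g b) ≤ 4 * (max g 0) * (max b 0) := by
  have l1 := tendsto_one_div_add_atTop_nhds_zero_nat (𝕜 := ℝ)
  have l2 : Tendsto (fun n : ℕ => 4 * (max g 0 + 1 / ((n:ℝ) + 1)) * (max b 0 + 1 / ((n:ℝ) + 1))) atTop
      (𝓝 (4 * (max g 0 + 0) * (max b 0 + 0))) := ((l1.const_add _).const_mul 4).mul (l1.const_add _)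
  simp only [add_zero] at l2
  refine ge_of_tendsto' l2 fun n => ?_
  have hp : 0 < 1 / ((n:ℝ) + 1) := by positivity
  have := hB.q_le0 (g := max g 0 + 1 / ((n:ℝ) + 1)) (b := max b 0 + 1 / ((n:ℝ) + 1)) (by positivity) (by positivity)
  refine le_trans (measureReal_mono (stayInf_mono ?_ ?_) (measure_ne_top _ _)) this
  · linarith [le_max_left g 0]
  · linarith [le_max_left b 0]

lemma IsBrownianMotion.q_ge [IsProbabilityMeasure P] (hB : IsBrownianMotion P B) {g b : ℝ}
    (hg : 0 < g) (hb : 0 < b) : 1 - Real.exp (-(g * b / 2)) ≤ P.real (stayInf B g b) := by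
  have main : ∀ N : ℕ, 1 - Real.exp (-(g * b / 2)) - 4 / b ^ 2 * (1 / ((N:ℝ) + 1)) ≤
      P.real (staySet B ((N:ℝ) + 1) g b) := by
    intro N
    set M : ℝ := (N:ℝ) + 1
    have hM : 0 < M := by positivity
    have h1 := hB.cheb hM.le (c := b / 2 * M) (by positivity)
    have h2 := hB.bridge_ge (θ := M) (g := g) (h := g + b / 2 * M) hM hg (by positivity)
    have h3 : P.real (bridgeSet B M g (g + b / 2 * M)) ≤ P.real (staySet B M g b) + P.real {ω | b / 2 * M ≤ |B M ω|} := by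
      refine le_trans (measureReal_mono ?_ (measure_ne_top _ _)) (measureReal_union_le _ _)
      intro ω hω
      by_cases hc : b / 2 * M ≤ |B M ω|
      · exact Or.inr hc
      left
      intro q q0 q1
      have a1 := hω q q0 q1
      have a2 := (abs_lt.1 (not_le.1 hc)).2
      have a3 : 0 ≤ (q:ℝ) / M := by positivity
      have a4 : (q:ℝ) / M * M = q := by field_simp
      have a5 := mul_le_mul_of_nonneg_left a2.le a3
      have e : (g + b / 2 * M - g) * (q / M) = b / 2 * (q / M * M) := by ring
      have e' : q / M * (b / 2 * M) = b / 2 * (q / M * M) := by ring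
      rw [e, a4] at a1; rw [e', a4] at a5; linarith
    have h4 : Real.exp (-(g * (g + b / 2 * M) / M)) ≤ Real.exp (-(g * b / 2)) := by
      apply Real.exp_le_exp.2
      have : g * (g + b / 2 * M) / M = g * g / M + g * b / 2 := by field_simp
      rw [this]
      have : 0 ≤ g * g / M := by positivity
      linarith
    have h5 : M / (b / 2 * M) ^ 2 = 4 / b ^ 2 * (1 / M) := by field_simp; ring
    rw [h5] at h1
    linarith
  have l1 := tendsto_one_div_add_atTop_nhds_zero_nat (𝕜 := ℝ)
  have e : stayInf B g b = ⋂ N : ℕ, staySet B ((N:ℝ) + 1) g b := by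
    ext ω
    simp only [mem_iInter]
    constructor
    · intro h N q q0 _; exact h q q0
    · intro h q q0
      obtain ⟨N, hN⟩ := exists_nat_ge (q : ℝ)
      exact h N q q0 (by linarith)
  have l3 : Tendsto (fun N : ℕ => P (staySet B ((N:ℝ) + 1) g b)) atTop (𝓝 (P (stayInf B g b))) := by
    rw [e]
    apply tendsto_measure_iInter_atTop
    · exact fun N => (measurableSet_staySet' fun q _ _ => hB.measurable q).nullMeasurableSet
    · intro N M hNM ω hω q q0 q1
      exact hω q q0 (by have : (N:ℝ) ≤ M := by exact_mod_cast hNM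
                        linarith)
    · exact ⟨0, measure_ne_top _ _⟩
  have l4 := (ENNReal.tendsto_toReal (measure_ne_top _ _)).comp l3
  have l5 : Tendsto (fun N : ℕ => 1 - Real.exp (-(g * b / 2)) - 4 / b ^ 2 * (1 / ((N:ℝ) + 1))) atTop
    (𝓝 (1 - Real.exp (-(g * b / 2)) - 4 / b ^ 2 * 0)) := (l1.const_mul _).const_sub _
  have := le_of_tendsto_of_tendsto' l5 l4 main
  simpa [Measure.real] using this

end part5

section part6
open scoped NNReal ENNReal
set_option linter.unusedSectionVars false
variable {Ω : Type*} {mΩ : MeasurableSpace Ω} {P : Measure Ω} {B : ℝ → Ω → ℝ}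

/-- properties of typical paths -/
structure GoodPath (f : ℝ → ℝ) : Prop where
  cont : ContinuousOn f (Ici 0)
  zero : f 0 = 0
  bdd : ∃ g b : ℝ, ∀ u, 0 ≤ u → f u ≤ g + b * u
  unb : ∀ g : ℝ, ∃ u, 0 ≤ u ∧ g < f u

lemma IsBrownianMotion.good [IsProbabilityMeasure P] (hB : IsBrownianMotion P B) :
    ∀ᵐ ω ∂P, GoodPath (fun u => B u ω) := by
  have h1 : ∀ᵐ ω ∂P, ∃ n : ℕ, ω ∈ stayInf B ((n:ℝ) + 1) 1 := by
    have hms : ∀ n : ℕ, MeasurableSet (stayInf B ((n:ℝ) + 1) 1) := fun n =>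
      measurableSet_stayInf' fun q _ => hB.measurable q
    have : P (⋃ n : ℕ, stayInf B ((n:ℝ) + 1) 1) = 1 := by
      have l : Tendsto (fun n : ℕ => 1 - Real.exp (-(((n:ℝ) + 1) * 1 / 2))) atTop (𝓝 (1 - 0)) := by
        refine Tendsto.const_sub 1 ?_
        refine Real.tendsto_exp_neg_atTop_nhds_zero.comp ?_
        have : (fun n : ℕ => ((n:ℝ) + 1) * 1 / 2) = fun n : ℕ => ((n:ℝ) + 1) / 2 := by simp
        rw [this]
        exact (tendsto_atTop_add_const_right _ _ tendsto_natCast_atTop_atTop).atTop_div_const (by norm_num)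
      have := le_of_tendsto' l (b := P.real (⋃ n : ℕ, stayInf B ((n:ℝ) + 1) 1)) fun n =>
        (hB.q_ge (by positivity) one_pos).trans (measureReal_mono (subset_iUnion (fun n : ℕ => stayInf B ((n:ℝ) + 1) 1) n)
          (measure_ne_top _ _))
      have h2 : P.real (⋃ n : ℕ, stayInf B ((n:ℝ) + 1) 1) ≤ 1 := measureReal_le_one
      have h3 : P.real (⋃ n : ℕ, stayInf B ((n:ℝ) + 1) 1) = 1 := by linarith
      rw [Measure.real, ENNReal.toReal_eq_one_iff] at h3
      exact h3
    rw [← mem_ae_iff_prob_eq_one (MeasurableSet.iUnion hms)] at this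
    filter_upwards [this] with ω hω
    simpa using hω
  have h2 : ∀ᵐ ω ∂P, ∀ n : ℕ, ω ∉ stayInf B n 0 := by
    rw [ae_all_iff]
    intro n
    have := hB.q_le n 0
    simp only [max_self, mul_zero] at this
    have h3 : P.real (stayInf B n 0) = 0 := le_antisymm this measureReal_nonneg
    rw [measureReal_eq_zero_iff] at h3
    exact measure_eq_zero_iff_ae_notMem.1 h3
  filter_upwards [hB.cont, hB.init, h1, h2] with ω hc h0 ⟨n, hn⟩ hu
  refine ⟨hc, h0, ⟨_, _, fun u hu => stayInf_real hc hn hu⟩, fun g => ?_⟩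
  obtain ⟨N, hN⟩ := exists_nat_ge g
  have := hu N
  simp only [stayInf, mem_ofPred_eq, not_forall, not_le] at this
  obtain ⟨q, q0, hq⟩ := this
  exact ⟨q, q0, by simp at hq; linarith⟩

lemma exists_line {f : ℝ → ℝ} {s k : ℝ} {S1 S2 : Set ℝ} (h1 : ∀ u ∈ S1, u < s) (h2 : ∀ w ∈ S2, s < w)
    (n1 : S1.Nonempty) (n2 : S2.Nonempty)
    (h : ∀ u ∈ S1, ∀ w ∈ S2, (w - s) * f u + (s - u) * f w ≤ k * (w - u)) :
    ∃ b : ℝ, (∀ u ∈ S1, f u ≤ k + b * (u - s)) ∧ ∀ w ∈ S2, f w ≤ k + b * (w - s) := by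
  have key : ∀ u ∈ S1, ∀ w ∈ S2, (f w - k) / (w - s) ≤ (k - f u) / (s - u) := by
    intro u hu w hw
    have := h1 u hu; have := h2 w hw
    rw [div_le_div_iff₀ (by linarith) (by linarith)]
    have := h u hu w hw
    nlinarith
  have hbdd : BddAbove ((fun w => (f w - k) / (w - s)) '' S2) := by
    obtain ⟨u, hu⟩ := n1
    refine ⟨(k - f u) / (s - u), ?_⟩
    rintro _ ⟨w, hw, rfl⟩
    exact key u hu w hw
  refine ⟨sSup ((fun w => (f w - k) / (w - s)) '' S2), fun u hu => ?_, fun w hw => ?_⟩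
  · have a : sSup ((fun w => (f w - k) / (w - s)) '' S2) ≤ (k - f u) / (s - u) := by
      apply csSup_le (n2.image _)
      rintro _ ⟨w, hw, rfl⟩
      exact key u hu w hw
    have := h1 u hu
    rw [le_div_iff₀ (by linarith)] at a
    linarith
  · have a := le_csSup hbdd (mem_image_of_mem _ hw)
    have := h2 w hw
    rw [div_le_iff₀ (by linarith)] at a
    linarith

lemma concaveOn_line (g b : ℝ) : ConcaveOn ℝ (Ici 0) (fun u : ℝ => g + b * u) := by
  refine ⟨convex_Ici 0, fun x _ y _ a c ha hc hac => ?_⟩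
  simp only [smul_eq_mul]
  have : g = (a + c) * g := by rw [hac, one_mul]
  nlinarith

lemma K_le_line {f : ℝ → ℝ} {g b t : ℝ} (h : ∀ u, 0 ≤ u → f u ≤ g + b * u) (ht : 0 ≤ t) :
    concaveMajorant f t ≤ g + b * t := by
  refine csInf_le ⟨f t, ?_⟩ ⟨_, concaveOn_line g b, h, rfl⟩
  rintro _ ⟨c, _, hc, rfl⟩
  exact hc t ht

lemma le_K {f : ℝ → ℝ} (hf : GoodPath f) {t y : ℝ}
    (h : ∀ c : ℝ → ℝ, ConcaveOn ℝ (Set.Ici 0) c → (∀ u, 0 ≤ u → f u ≤ c u) → y ≤ c t) :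
    y ≤ concaveMajorant f t := by
  obtain ⟨g, b, hgb⟩ := hf.bdd
  refine le_csInf ⟨_, _, concaveOn_line g b, hgb, rfl⟩ ?_
  rintro _ ⟨c, h1, h2, rfl⟩
  exact h c h1 h2

lemma GoodPath.f_le_K {f : ℝ → ℝ} (hf : GoodPath f) {t : ℝ} (ht : 0 ≤ t) : f t ≤ concaveMajorant f t :=
  le_K hf fun _ _ h => h t ht

lemma GoodPath.chord_le_K {f : ℝ → ℝ} (hf : GoodPath f) {u s w : ℝ} (hu : 0 ≤ u) (hus : u < s) (hsw : s < w) :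
    (w - s) * f u + (s - u) * f w ≤ concaveMajorant f s * (w - u) := by
  have hp : 0 < w - u := by linarith
  rw [← div_le_iff₀ hp]
  refine le_K hf fun c hc h => ?_
  have := hc.2 (show u ∈ Ici (0:ℝ) from hu) (show w ∈ Ici (0:ℝ) by simp; linarith)
    (show 0 ≤ (w - s) / (w - u) by apply div_nonneg <;> linarith)
    (show 0 ≤ (s - u) / (w - u) by apply div_nonneg <;> linarith) (by field_simp; ring)
  simp only [smul_eq_mul] at this
  have e : (w - s) / (w - u) * u + (s - u) / (w - u) * w = s := by field_simp; ring
  rw [e] at this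
  refine le_trans ?_ this
  rw [div_le_iff₀ hp]
  have e2 : ((w - s) / (w - u) * c u + (s - u) / (w - u) * c w) * (w - u) = (w - s) * c u + (s - u) * c w := by
    field_simp
  rw [e2]
  have a1 := h u hu
  have a2 := h w (by linarith)
  have a3 : 0 ≤ w - s := by linarith
  have a4 : 0 ≤ s - u := by linarith
  gcongr

lemma GoodPath.slope_pos {f : ℝ → ℝ} (hf : GoodPath f) {g b : ℝ} (h : ∀ u, 0 ≤ u → f u ≤ g + b * u) : 0 < b := by
  by_contra hb
  obtain ⟨u, hu, h2⟩ := hf.unb g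
  nlinarith [h u hu]

/-- supporting line -/
lemma GoodPath.support {f : ℝ → ℝ} (hf : GoodPath f) {s : ℝ} (hs : 0 < s) :
    ∃ b : ℝ, 0 < b ∧ (∀ u, 0 ≤ u → f u ≤ concaveMajorant f s + b * (u - s)) := by
  obtain ⟨b, h1, h2⟩ := exists_line (f := f) (s := s) (k := concaveMajorant f s) (S1 := Ico 0 s) (S2 := Ioi s)
    (fun u hu => hu.2) (fun w hw => hw) ⟨0, le_rfl, hs⟩ ⟨s + 1, by simp⟩
    (fun u hu w hw => hf.chord_le_K hu.1 hu.2 hw)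
  have h3 : ∀ u, 0 ≤ u → f u ≤ concaveMajorant f s + b * (u - s) := by
    intro u hu
    rcases lt_trichotomy u s with h | h | h
    · exact h1 u ⟨hu, h⟩
    · rw [h]; simpa using hf.f_le_K hs.le
    · exact h2 u h
  refine ⟨b, hf.slope_pos (g := concaveMajorant f s - b * s) (b := b) fun u hu => ?_, h3⟩
  have := h3 u hu
  linarith

lemma GoodPath.K_mono {f : ℝ → ℝ} (hf : GoodPath f) {v w : ℝ} (hv : 0 ≤ v) (hw : 0 < w) (hvw : v ≤ w) :
    concaveMajorant f v ≤ concaveMajorant f w := by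
  obtain ⟨b, hb, h⟩ := hf.support hw
  have := K_le_line (f := f) (g := concaveMajorant f w - b * w) (b := b) (t := v)
    (fun u hu => by have := h u hu; linarith) hv
  nlinarith

lemma GoodPath.K_nonneg {f : ℝ → ℝ} (hf : GoodPath f) {s : ℝ} (hs : 0 < s) : 0 ≤ concaveMajorant f s := by
  obtain ⟨b, hb, h⟩ := hf.support hs
  have := h 0 le_rfl
  rw [hf.zero] at this
  nlinarith [mul_pos hb hs]

lemma GoodPath.K_le_mul {f : ℝ → ℝ} (hf : GoodPath f) {s v : ℝ} (hs : 0 < s) (hv : s ≤ v) :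
    concaveMajorant f v ≤ v / s * concaveMajorant f s := by
  obtain ⟨b, hb, h⟩ := hf.support hs
  have h0 := h 0 le_rfl
  rw [hf.zero] at h0
  have := K_le_line (f := f) (g := concaveMajorant f s - b * s) (b := b) (t := v)
    (fun u hu => by have := h u hu; linarith) (by linarith)
  have h2 : b * (v - s) ≤ concaveMajorant f s / s * (v - s) := by
    apply mul_le_mul_of_nonneg_right _ (by linarith)
    rw [le_div_iff₀ hs]; linarith
  have e : v / s * concaveMajorant f s = concaveMajorant f s + concaveMajorant f s / s * (v - s) := by
    field_simp; ring
  rw [e]; linarith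

/-- index set of chords straddling the tent -/
abbrev ChordIdx (θ : ℝ) := {p : ℚ × ℚ // 0 ≤ (p.1 : ℝ) ∧ (p.1 : ℝ) ≤ 2 - θ ∧ 2 + θ ≤ (p.2 : ℝ)}

/-- best chord value at time `2` -/
noncomputable def kappa (θ : ℝ) (f : ℝ → ℝ) : ℝ :=
  ⨆ p : ChordIdx θ, ((p.1.2 - 2) * f p.1.1 + (2 - p.1.1) * f p.1.2) / (p.1.2 - p.1.1)

lemma kappa_eq {f : ℝ → ℝ} (hf : GoodPath f) {θ : ℝ} (h0 : 0 < θ) (h1 : θ < 2)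
    (hneg : ∀ u, 2 - θ ≤ u → u ≤ 2 + θ → f u ≤ 0) : concaveMajorant f 2 = kappa θ f := by
  have hne : Nonempty (ChordIdx θ) := by
    obtain ⟨N, hN⟩ := exists_nat_ge (2 + θ)
    exact ⟨⟨(0, N), by simp; constructor <;> linarith⟩⟩
  have hle : ∀ p : ChordIdx θ, ((p.1.2 - 2) * f p.1.1 + (2 - p.1.1) * f p.1.2) / (p.1.2 - p.1.1) ≤ concaveMajorant f 2 := by
    rintro ⟨⟨u, w⟩, a1, a2, a3⟩
    simp only at *
    rw [div_le_iff₀ (by linarith)]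
    exact hf.chord_le_K a1 (by linarith) (by linarith)
  apply le_antisymm _ (ciSup_le hle)
  have hbdd : BddAbove (range fun p : ChordIdx θ => ((p.1.2 - 2) * f p.1.1 + (2 - p.1.1) * f p.1.2) / (p.1.2 - p.1.1)) := by
    refine ⟨concaveMajorant f 2, ?_⟩
    rintro _ ⟨p, rfl⟩
    exact hle p
  obtain ⟨b, e1, e2⟩ := exists_line (f := f) (s := 2) (k := kappa θ f) (S1 := {u | 0 ≤ u ∧ u ≤ 2 - θ ∧ ∃ q : ℚ, u = q})
    (S2 := {w | 2 + θ ≤ w ∧ ∃ q : ℚ, w = q}) (fun u hu => by have := hu.2.1; linarith)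
    (fun w hw => by have := hw.1; linarith) ⟨0, le_rfl, by linarith, 0, by simp⟩
    (by obtain ⟨N, hN⟩ := exists_nat_ge (2 + θ)
        exact ⟨N, hN, N, by simp⟩) (by
      rintro _ ⟨u0, u1, u, rfl⟩ _ ⟨w0, w, rfl⟩
      have := le_ciSup hbdd ⟨(u, w), u0, u1, w0⟩
      simp only at this
      rw [div_le_iff₀ (by linarith)] at this
      exact this)
  have r1 : ∀ v, 0 ≤ v → v ≤ 2 - θ → f v ≤ kappa θ f + b * (v - 2) :=
    rat_to_real (f := f) (l := fun v => kappa θ f + b * (v - 2)) (hf.cont.mono Icc_subset_Ici_self) (by fun_prop) (by linarith)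
      fun q a1 a2 => e1 q ⟨a1, a2, q, rfl⟩
  have r2 : ∀ v, 2 + θ ≤ v → f v ≤ kappa θ f + b * (v - 2) := fun v hv =>
    rat_to_real (f := f) (l := fun v => kappa θ f + b * (v - 2)) (a := 2 + θ) (θ := v + 1)
      (hf.cont.mono fun x hx => by have := hx.1; simp; linarith) (by fun_prop) (by linarith)
      (fun q a1 a2 => e2 q ⟨a1, q, rfl⟩) v hv (by linarith)
  have c0 : 0 ≤ kappa θ f + b * (0 - 2) := by
    have := r1 0 le_rfl (by linarith)
    rwa [hf.zero] at this
  have hb : 0 < b := by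
    by_contra hb
    push Not at hb
    obtain ⟨u, hu, h2⟩ := hf.unb (kappa θ f + b * (0 - 2))
    rcases le_or_gt u (2 - θ) with h | h
    · nlinarith [r1 u hu h]
    rcases le_or_gt u (2 + θ) with h' | h'
    · linarith [hneg u h.le h']
    · nlinarith [r2 u h'.le]
  have := K_le_line (f := f) (g := kappa θ f - b * 2) (b := b) (t := 2) (fun u hu => by
    rcases le_or_gt u (2 - θ) with h | h
    · linarith [r1 u hu h]
    rcases le_or_gt u (2 + θ) with h' | h'
    · nlinarith [hneg u h.le h']
    · linarith [r2 u h'.le]) (by norm_num)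
  show _ ≤ kappa θ f
  linarith

lemma kappa_congr {f g : ℝ → ℝ} {θ : ℝ} (h1 : ∀ u, u ≤ 2 - θ → f u = g u) (h2 : ∀ u, 2 + θ ≤ u → f u = g u) :
    kappa θ f = kappa θ g := by
  unfold kappa
  congr 1; ext ⟨⟨u, w⟩, a1, a2, a3⟩
  simp only [h1 _ a2, h2 _ a3]

end part6

section part7
open scoped NNReal ENNReal
set_option linter.unusedSectionVars false
variable {Ω : Type*} {mΩ : MeasurableSpace Ω} {P : Measure Ω} {B : ℝ → Ω → ℝ}

/-- tent function around time 2 -/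
noncomputable def tent (θ v : ℝ) : ℝ := max 0 (1 - |v - 2| / θ)

/-- height of `B` at 2 above the chord -/
noncomputable def zeta (B : ℝ → Ω → ℝ) (θ : ℝ) (ω : Ω) : ℝ := 1 * B 2 ω + (-1/2) * B (2 - θ) ω + (-1/2) * B (2 + θ) ω

/-- `B` with the tent removed -/
noncomputable def perp (B : ℝ → Ω → ℝ) (θ v : ℝ) (ω : Ω) : ℝ := B v ω - tent θ v * zeta B θ ω

lemma tent_left {θ v : ℝ} (hθ : 0 < θ) (hv : v ≤ 2 - θ) : tent θ v = 0 := by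
  apply max_eq_left
  have : 1 ≤ |v - 2| / θ := by rw [one_le_div hθ, abs_sub_comm]; exact le_trans (by linarith) (le_abs_self _)
  linarith

lemma tent_right {θ v : ℝ} (hθ : 0 < θ) (hv : 2 + θ ≤ v) : tent θ v = 0 := by
  apply max_eq_left
  have : 1 ≤ |v - 2| / θ := by rw [one_le_div hθ]; exact le_trans (by linarith) (le_abs_self _)
  linarith

lemma tent_two {θ : ℝ} : tent θ 2 = 1 := by simp [tent]

lemma tent_nonneg {θ v : ℝ} : 0 ≤ tent θ v := le_max_left _ _

lemma tent_mid1 {θ v : ℝ} (hθ : 0 < θ) (h1 : 2 - θ ≤ v) (h2 : v ≤ 2) : tent θ v = (v - 2 + θ) / θ := by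
  unfold tent
  rw [abs_sub_comm, abs_of_nonneg (by linarith), max_eq_right]
  · field_simp; ring
  · rw [sub_nonneg, div_le_one hθ]; linarith

lemma tent_mid2 {θ v : ℝ} (hθ : 0 < θ) (h1 : v ≤ 2 + θ) (h2 : 2 ≤ v) : tent θ v = (2 + θ - v) / θ := by
  unfold tent
  rw [abs_of_nonneg (by linarith), max_eq_right]
  · field_simp; ring
  · rw [sub_nonneg, div_le_one hθ]; linarith

lemma IsBrownianMotion.tent_indep [IsProbabilityMeasure P] (hB : IsBrownianMotion P B) {θ : ℝ} (h0 : 0 < θ) (h1 : θ < 2) :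
    Indep (MeasurableSpace.comap (zeta B θ) inferInstance) (procSigma (perp B θ)) P ∧
      P.map (zeta B θ) = gaussianReal 0 (θ / 2).toNNReal := by
  have key := hB.indep_linR (ι := Ici (0:ℝ)) (a := 2) (b := 2 - θ) (c := 2 + θ) (by norm_num) (by linarith) (by linarith)
    1 (-1/2) (-1/2) (fun i => i.1) (fun i => i.2) (fun i => tent θ i.1) (θ / 2)
    (by rw [min_eq_left (by linarith : (2:ℝ) ≤ 2 + θ), min_eq_right (by linarith : 2 - θ ≤ 2), min_eq_left (by linarith : 2 - θ ≤ 2),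
          min_eq_left (by linarith : 2 - θ ≤ 2 + θ), min_eq_right (by linarith : 2 - θ ≤ 2 + θ),
          min_eq_right (by linarith : (2:ℝ) ≤ 2 + θ)]
        simp only [min_self]; ring)
    (by
      rintro ⟨v, hv⟩
      simp only
      rcases le_total v (2 - θ) with h | h
      · rw [tent_left h0 h, min_eq_right (by linarith), min_eq_right (by linarith), min_eq_right (by linarith)]; ring
      rcases le_total v 2 with h' | h'
      · rw [tent_mid1 h0 h h', min_eq_right (by linarith), min_eq_left (by linarith), min_eq_right (by linarith)]
        field_simp; ring
      rcases le_total v (2 + θ) with h2 | h2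
      · rw [tent_mid2 h0 h2 h', min_eq_left (by linarith), min_eq_left (by linarith), min_eq_right (by linarith)]
        field_simp; ring
      · rw [tent_right h0 h2, min_eq_left (by linarith), min_eq_left (by linarith), min_eq_left (by linarith)]; ring)
  refine ⟨?_, key.2⟩
  refine indep_of_indep_of_le_right key.1 ?_
  refine iSup_le fun u => ?_
  refine Measurable.comap_le ?_
  have h1 := comap_measurable (m := MeasurableSpace.pi) (fun ω (i : Ici (0:ℝ)) => B i.1 ω - tent θ i.1 * (1 * B 2 ω + (-1/2) * B (2 - θ) ω + (-1/2) * B (2 + θ) ω))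
  exact (measurable_pi_apply u).comp h1

lemma IsBrownianMotion.zeta_meas (hB : IsBrownianMotion P B) (θ : ℝ) : Measurable (zeta B θ) := by
  have := hB.measurable
  unfold zeta; fun_prop

lemma IsBrownianMotion.perp_meas (hB : IsBrownianMotion P B) (θ v : ℝ) : Measurable (perp B θ v) := by
  have := hB.measurable; have := hB.zeta_meas θ
  unfold perp; fun_prop

lemma perp_left {θ v : ℝ} (hθ : 0 < θ) (hv : v ≤ 2 - θ) : perp B θ v = B v := by
  ext ω; simp [perp, tent_left hθ hv]

lemma perp_right {θ v : ℝ} (hθ : 0 < θ) (hv : 2 + θ ≤ v) : perp B θ v = B v := by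
  ext ω; simp [perp, tent_right hθ hv]

lemma meas_perp_left {θ v : ℝ} (hθ : 0 < θ) (h0 : 0 ≤ v) (hv : v ≤ 2 - θ) : Measurable[procSigma (perp B θ)] (B v) := by
  have := meas_procSigma (B := perp B θ) h0
  rwa [perp_left hθ hv] at this

lemma meas_perp_right {θ v : ℝ} (hθ : 0 < θ) (hv : 2 + θ ≤ v) : Measurable[procSigma (perp B θ)] (B v) := by
  have := meas_procSigma (B := perp B θ) (show 0 ≤ v by linarith)
  rwa [perp_right hθ hv] at this

/-- the centre of the law of `X 2` given the rest -/
noncomputable def centre (B : ℝ → Ω → ℝ) (θ : ℝ) (ω : Ω) : ℝ :=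
  2 * kappa θ (fun u => B u ω) - (B (2 - θ) ω + B (2 + θ) ω) / 2

lemma centre_meas {θ : ℝ} (hθ : 0 < θ) (h2 : θ < 2) : Measurable[procSigma (perp B θ)] (centre B θ) := by
  have hk : Measurable[procSigma (perp B θ)] (fun ω => kappa θ (fun u => B u ω)) := by
    unfold kappa
    refine Measurable.iSup fun p => ?_
    have a1 := meas_perp_left (B := B) hθ p.2.1 p.2.2.1
    have a2 := meas_perp_right (B := B) hθ p.2.2.2
    exact ((a1.const_mul _).add (a2.const_mul _)).div_const _
  have a1 := meas_perp_left (B := B) hθ (show 0 ≤ 2 - θ by linarith) le_rfl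
  have a2 := meas_perp_right (B := B) hθ (le_refl (2 + θ))
  exact (hk.const_mul 2).sub ((a1.add a2).div_const 2)

lemma centre_eq {θ : ℝ} {ω : Ω} (hf : GoodPath (fun u => B u ω)) (hθ : 0 < θ) (h2 : θ < 2)
    (hneg : ∀ u, 2 - θ ≤ u → u ≤ 2 + θ → B u ω ≤ 0) : Xproc B 2 ω = centre B θ ω - zeta B θ ω := by
  unfold Xproc Kproc centre zeta
  rw [kappa_eq hf hθ h2 hneg]
  ring

lemma vol_sub_left (c : ℝ) {J : Set ℝ} (hJ : MeasurableSet J) : volume {z : ℝ | c - z ∈ J} = volume J := by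
  have := (Measure.measurePreserving_sub_left volume c).measure_preimage hJ.nullMeasurableSet
  exact this

lemma IsBrownianMotion.tent_le [IsProbabilityMeasure P] (hB : IsBrownianMotion P B) {θ : ℝ} (h0 : 0 < θ) (h1 : θ < 2)
    {E : Set Ω} (hE : MeasurableSet[procSigma (perp B θ)] E) {J S : Set ℝ} (hJ : MeasurableSet J) (hS : MeasurableSet S)
    {M : ℝ} (hM : ∀ z ∈ S, gaussianPDFReal 0 (θ / 2).toNNReal z ≤ M) :
    P (E ∩ {ω | centre B θ ω - zeta B θ ω ∈ J ∧ zeta B θ ω ∈ S}) ≤ ENNReal.ofReal M * volume J * P E := by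
  obtain ⟨hi, hl⟩ := hB.tent_indep h0 h1
  have hz := hB.zeta_meas θ
  have hR : MeasurableSet {p : ℝ × ℝ | p.1 - p.2 ∈ J ∧ p.2 ∈ S} :=
    ((measurable_fst.sub measurable_snd) hJ).inter (measurable_snd hS)
  refine indep_le (procSigma_le_of_meas (hB.perp_meas θ)) hz.comap_le hi (centre_meas h0 h1) (comap_measurable _) hE hR ?_
  intro ω _
  have hv : (θ / 2).toNNReal ≠ 0 := by simpa using h0
  have hm : MeasurableSet {z : ℝ | centre B θ ω - z ∈ J} := (measurable_id.const_sub _) hJ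
  calc P {ω' | (centre B θ ω, zeta B θ ω') ∈ {p : ℝ × ℝ | p.1 - p.2 ∈ J ∧ p.2 ∈ S}}
      = gaussianReal 0 (θ / 2).toNNReal ({z | centre B θ ω - z ∈ J} ∩ S) := by
        rw [← hl, Measure.map_apply hz (hm.inter hS)]; rfl
    _ ≤ ENNReal.ofReal M * volume ({z | centre B θ ω - z ∈ J} ∩ S) := gauss_le hv (hm.inter hS) fun z hz => hM z hz.2
    _ ≤ ENNReal.ofReal M * volume {z | centre B θ ω - z ∈ J} := by gcongr; exact inter_subset_left
    _ = _ := by rw [vol_sub_left _ hJ]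

lemma IsBrownianMotion.tent_ge [IsProbabilityMeasure P] (hB : IsBrownianMotion P B) {θ : ℝ} (h0 : 0 < θ) (h1 : θ < 2)
    {E : Set Ω} (hE : MeasurableSet[procSigma (perp B θ)] E) {J : Set ℝ} (hJ : MeasurableSet J)
    {R : ℝ} (hR' : ∀ ω ∈ E, ∀ x ∈ J, |centre B θ ω - x| ≤ R) :
    ENNReal.ofReal (gaussianPDFReal 0 (θ / 2).toNNReal R) * volume J * P E ≤ P (E ∩ {ω | centre B θ ω - zeta B θ ω ∈ J}) := by
  obtain ⟨hi, hl⟩ := hB.tent_indep h0 h1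
  have hz := hB.zeta_meas θ
  have hR : MeasurableSet {p : ℝ × ℝ | p.1 - p.2 ∈ J} := ((measurable_fst.sub measurable_snd) hJ)
  refine indep_ge (procSigma_le_of_meas (hB.perp_meas θ)) hz.comap_le hi (centre_meas h0 h1) (comap_measurable _) hE hR ?_
  intro ω hω
  have hv : (θ / 2).toNNReal ≠ 0 := by simpa using h0
  have hm : MeasurableSet {z : ℝ | centre B θ ω - z ∈ J} := (measurable_id.const_sub _) hJ
  calc ENNReal.ofReal (gaussianPDFReal 0 (θ / 2).toNNReal R) * volume J
      = ENNReal.ofReal (gaussianPDFReal 0 (θ / 2).toNNReal R) * volume {z | centre B θ ω - z ∈ J} := by rw [vol_sub_left _ hJ]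
    _ ≤ gaussianReal 0 (θ / 2).toNNReal {z | centre B θ ω - z ∈ J} := gauss_ge hv hm fun z hz => pdf_ge (by
        have := hR' ω hω _ hz
        simpa using this)
    _ = _ := by rw [← hl, Measure.map_apply hz hm]; rfl

lemma IsBrownianMotion.neg (hB : IsBrownianMotion P B) : IsBrownianMotion P (fun t ω => - B t ω) where
  measurable t := (hB.measurable t).neg
  init := by filter_upwards [hB.init] with ω h; simp [h]
  cont := by filter_upwards [hB.cont] with ω h; exact h.neg
  incr_law s t hs hst := by
    have h := hB.incr_law s t hs hst
    have e : (fun ω => - B t ω - - B s ω) = (fun x => -x) ∘ (fun ω => B t ω - B s ω) := by ext ω; simp; ring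
    rw [e, ← Measure.map_map (f := fun ω => B t ω - B s ω) (g := fun x => -x) measurable_neg ((hB.measurable t).sub (hB.measurable s)), h]
    have := gaussianReal_map_neg (μ := 0) (v := (t - s).toNNReal)
    simpa using this
  incr_indep s t hs hst := by
    have h := hB.incr_indep s t hs hst
    refine indep_of_indep_of_le_left (indep_of_indep_of_le_right h ?_) ?_
    · refine iSup_le fun u => ?_
      refine Measurable.comap_le ?_
      exact (meas_natSigma (B := B) u.2.1 u.2.2).neg
    · refine Measurable.comap_le ?_
      have : (fun ω => - B t ω - - B s ω) = fun ω => -(B t ω - B s ω) := by ext; ring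
      rw [this]
      exact (comap_measurable _).neg

lemma IsBrownianMotion.max_le [IsProbabilityMeasure P] (hB : IsBrownianMotion P B) {θ g : ℝ} (hθ : 0 < θ) (hg : 0 < g) :
    P (crossSet B θ g) ≤ ENNReal.ofReal (2 * θ / g ^ 2) := by
  have h1 := hB.refl_le hθ g g
  have hc := hB.cheb hθ.le hg
  have h2 : P {ω | g ≤ B θ ω} ≤ ENNReal.ofReal (θ / g ^ 2) := by
    refine (measure_mono fun ω hω => ?_).trans ((ENNReal.le_ofReal_iff_toReal_le (measure_ne_top P {ω | g ≤ |B θ ω|}) (by positivity)).2 hc)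
    exact le_trans (show g ≤ B θ ω from hω) (le_abs_self _)
  have e : 2 * g - g = g := by ring
  rw [e] at h1
  calc P (crossSet B θ g) ≤ P ((crossSet B θ g ∩ {ω | B θ ω ≤ g}) ∪ {ω | g ≤ B θ ω}) := by
        apply measure_mono
        intro ω hω
        rcases le_total (B θ ω) g with h | h
        · exact Or.inl ⟨hω, h⟩
        · exact Or.inr h
    _ ≤ ENNReal.ofReal (θ / g ^ 2) + ENNReal.ofReal (θ / g ^ 2) := (measure_union_le _ _).trans (add_le_add (h1.trans h2) h2)
    _ = _ := by rw [← ENNReal.ofReal_add (by positivity) (by positivity)]; congr 1; ring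

end part7

section part8
open scoped NNReal ENNReal
set_option linter.unusedSectionVars false
variable {Ω : Type*} {mΩ : MeasurableSpace Ω} {P : Measure Ω} {B : ℝ → Ω → ℝ}

/-- time shift -/
def shiftP (B : ℝ → Ω → ℝ) (s : ℝ) : ℝ → Ω → ℝ := fun v ω => B (s + v) ω - B s ω

lemma pdf_le_exp {v : ℝ≥0} {r z : ℝ} (hr : 0 < r) (h : r ^ 2 ≤ 2 * Real.pi * v) :
    gaussianPDFReal 0 v z ≤ 1 / r * Real.exp (- z ^ 2 / (2 * v)) := by
  simp only [gaussianPDFReal, sub_zero, one_div]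
  have : r ≤ √(2 * Real.pi * v) := Real.le_sqrt_of_sq_le h
  gcongr

lemma pdf_le_of_sq {v : ℝ≥0} {r z : ℝ} (hr : 0 < r) (h : r ^ 2 ≤ 2 * Real.pi * v) :
    gaussianPDFReal 0 v z ≤ 1 / r := by
  refine (pdf_le_exp hr h).trans ?_
  have : Real.exp (- z ^ 2 / (2 * v)) ≤ 1 := by
    apply Real.exp_le_one_iff.2
    have : 0 ≤ z ^ 2 / (2 * v) := by positivity
    rw [neg_div]; linarith
  have h2 : 0 ≤ 1 / r := by positivity
  nlinarith

lemma gauss_window_le {v : ℝ≥0} (hv : 1 ≤ 2 * Real.pi * v) {a b : ℝ} :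
    gaussianReal 0 v (Icc a b) ≤ ENNReal.ofReal (b - a) := by
  have hv0 : v ≠ 0 := by rintro rfl; simp at hv; linarith
  have := gauss_le hv0 (S := Icc a b) measurableSet_Icc (M := 1) fun z _ => by
    simpa using pdf_le_of_sq (r := 1) (z := z) one_pos (by simpa using hv)
  simpa using this

lemma IsBrownianMotion.stay_one_le [IsProbabilityMeasure P] (hB : IsBrownianMotion P B) {δ : ℝ} (hδ : 0 < δ) :
    P (staySet B 1 δ 0) ≤ ENNReal.ofReal (2 * δ) := by
  have h := hB.stay_Iic one_pos hδ.le (le_refl δ)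
  have e : 2 * δ - δ = δ := by ring
  have e2 : (gaussianReal 0 (1:ℝ).toNNReal).real (Ici δ) = (gaussianReal 0 (1:ℝ).toNNReal).real (Iic (-δ)) := by
    simp only [Measure.real, gaussian_symm]
  have e3 : Iic δ = Iic (-δ) ∪ Ioc (-δ) δ := (Iic_union_Ioc_eq_Iic (by linarith)).symm
  rw [e, e2, e3, measureReal_union (disjoint_left.2 fun x h1 h2 => by simp at h1 h2; linarith [h2.1]) measurableSet_Ioc] at h
  have h2 : P.real (staySet B 1 δ 0 ∩ {ω | B 1 ω ≤ δ}) = (gaussianReal 0 (1:ℝ).toNNReal).real (Ioc (-δ) δ) := by linarith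
  have h3 : staySet B 1 δ 0 ∩ {ω | B 1 ω ≤ δ} = staySet B 1 δ 0 := by
    apply inter_eq_left.2
    intro ω hω
    have := hω 1 (by simp) (by simp)
    simpa using this
  rw [h3] at h2
  have h4 : P (staySet B 1 δ 0) = gaussianReal 0 (1:ℝ).toNNReal (Ioc (-δ) δ) := by
    rwa [Measure.real, Measure.real, ENNReal.toReal_eq_toReal_iff' (measure_ne_top _ _) (measure_ne_top _ _)] at h2
  rw [h4]
  refine (measure_mono Ioc_subset_Icc_self).trans ((gauss_window_le ?_).trans (le_of_eq ?_))
  · simp; linarith [Real.pi_gt_three]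
  · congr 1; ring

/-- oscillation event -/
def oscSet (B : ℝ → Ω → ℝ) (θ : ℝ) : Set Ω :=
  {ω | (∃ q : ℚ, 0 ≤ (q:ℝ) ∧ (q:ℝ) ≤ 8 * θ ∧ 1/8 < |shiftP B (2 - 4 * θ) q ω|) ∨
    1/8 < |shiftP B (2 - 4 * θ) (3 * θ) ω| ∨ 1/8 < |shiftP B (2 - 4 * θ) (5 * θ) ω|}

lemma oscSet_meas' {m : MeasurableSpace Ω} {θ : ℝ} (h0 : 0 ≤ θ)
    (h : ∀ v, 0 ≤ v → v ≤ 8 * θ → Measurable[m] (shiftP B (2 - 4 * θ) v)) : MeasurableSet[m] (oscSet B θ) := by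
  have hh : ∀ v, 0 ≤ v → v ≤ 8 * θ → MeasurableSet[m] {ω | 1/8 < |shiftP B (2 - 4 * θ) v ω|} := by
    intro v a b
    have : MeasurableSet {x : ℝ | 1/8 < |x|} := measurableSet_lt measurable_const (by fun_prop)
    exact h v a b this
  have e : oscSet B θ = (⋃ q : ℚ, ⋃ (_ : 0 ≤ (q:ℝ)), ⋃ (_ : (q:ℝ) ≤ 8 * θ), {ω | 1/8 < |shiftP B (2 - 4 * θ) q ω|}) ∪
      ({ω | 1/8 < |shiftP B (2 - 4 * θ) (3 * θ) ω|} ∪ {ω | 1/8 < |shiftP B (2 - 4 * θ) (5 * θ) ω|}) := by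
    ext ω; simp only [oscSet, mem_ofPred_eq, mem_union, mem_iUnion, exists_prop]
  rw [e]
  refine MeasurableSet.union (MeasurableSet.iUnion fun q => MeasurableSet.iUnion fun a => MeasurableSet.iUnion fun b => hh q a b)
    ((hh _ (by linarith) (by linarith)).union (hh _ (by linarith) (by linarith)))

lemma IsBrownianMotion.osc_le [IsProbabilityMeasure P] (hB : IsBrownianMotion P B) {θ : ℝ} (h0 : 0 < θ) (h1 : 4 * θ ≤ 2) :
    P (oscSet B θ) ≤ ENNReal.ofReal (2048 * θ) := by
  have hs : IsBrownianMotion P (shiftP B (2 - 4 * θ)) := hB.shift (by linarith)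
  have a1 := hs.max_le (θ := 8 * θ) (g := 1/8) (by linarith) (by norm_num)
  have a2 := hs.neg.max_le (θ := 8 * θ) (g := 1/8) (by linarith) (by norm_num)
  have hsub : oscSet B θ ⊆ crossSet (shiftP B (2 - 4 * θ)) (8 * θ) (1/8) ∪
      crossSet (fun t ω => - shiftP B (2 - 4 * θ) t ω) (8 * θ) (1/8) := by
    have aux : ∀ v ω, 0 ≤ v → v ≤ 8 * θ → 1/8 < |shiftP B (2 - 4 * θ) v ω| →
      ω ∈ crossSet (shiftP B (2 - 4 * θ)) (8 * θ) (1/8) ∪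
      crossSet (fun t ω => - shiftP B (2 - 4 * θ) t ω) (8 * θ) (1/8) := by
      intro v ω b1 b2 b3
      rcases lt_abs.1 b3 with h | h
      · exact Or.inl ⟨v, b1, b2, h⟩
      · exact Or.inr ⟨v, b1, b2, h⟩
    rintro ω (⟨q, b1, b2, b3⟩ | b | b)
    · exact aux _ _ b1 b2 b3
    · exact aux _ _ (by linarith) (by linarith) b
    · exact aux _ _ (by linarith) (by linarith) b
  refine (measure_mono hsub).trans ((measure_union_le _ _).trans ((add_le_add a1 a2).trans (le_of_eq ?_)))
  rw [← ENNReal.ofReal_add (by positivity) (by positivity)]; congr 1; ring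

lemma shiftP_meas_nat {s v t : ℝ} (hs : 0 ≤ s) (hv : 0 ≤ v) (ht : s + v ≤ t) : Measurable[natSigma B t] (shiftP B s v) :=
  (meas_natSigma (by linarith) ht).sub (meas_natSigma hs (by linarith))

lemma IsBrownianMotion.stay_osc_le [IsProbabilityMeasure P] (hB : IsBrownianMotion P B) {θ δ : ℝ} (h0 : 0 < θ) (h1 : 4 * θ ≤ 1)
    (hδ : 0 < δ) : P (staySet B 1 δ 0 ∩ oscSet B θ) ≤ ENNReal.ofReal (2 * δ * (2048 * θ)) := by
  have hi := hB.indep_shift (s := 2 - 4 * θ) (by linarith)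
  have m1 : MeasurableSet[natSigma B (2 - 4 * θ)] (staySet B 1 δ 0) :=
    measurableSet_staySet' fun q a b => meas_natSigma a (by linarith)
  have m2 : MeasurableSet[procSigma (shiftP B (2 - 4 * θ))] (oscSet B θ) :=
    oscSet_meas' h0.le fun v a b => meas_procSigma a
  have := (Indep_iff _ _ _).1 hi.symm
  rw [this _ _ m1 m2, ENNReal.ofReal_mul (by positivity)]
  exact mul_le_mul' (hB.stay_one_le hδ) (hB.osc_le h0 (by linarith))

lemma IsBrownianMotion.base_le [IsProbabilityMeasure P] (hB : IsBrownianMotion P B) {δ p : ℝ} (hδ : 0 < δ) (hp : 0 ≤ p)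
    {O : Set Ω} (hO : MeasurableSet[natSigma B (5/2)] O) (h : P (staySet B 1 δ 0 ∩ O) ≤ ENNReal.ofReal (2 * δ * p)) :
    P (staySet B 1 δ 0 ∩ O ∩ {ω | |B 3 ω| ≤ δ} ∩ stayInf (shiftP B 3) (2 * δ) (δ / 3)) ≤ ENNReal.ofReal (11 * δ ^ 4 * p) := by
  have m1 : MeasurableSet[natSigma B (5/2)] (staySet B 1 δ 0 ∩ O) :=
    (measurableSet_staySet' fun q a b => meas_natSigma a (by linarith)).inter hO
  have hY : Measurable (fun ω => B 3 ω - B (5/2) ω) := (hB.measurable _).sub (hB.measurable _)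
  have s1 : P ((staySet B 1 δ 0 ∩ O) ∩ {ω | |B 3 ω| ≤ δ}) ≤ ENNReal.ofReal (2 * δ) * P (staySet B 1 δ 0 ∩ O) := by
    have := indep_le (natSigma_le_of_meas hB.measurable (5/2)) hY.comap_le
      (hB.incr_indep (5/2) 3 (by norm_num) (by norm_num)) (meas_natSigma (B := B) (u := 5/2) (by norm_num) le_rfl) (comap_measurable _) m1
      (R := {p : ℝ × ℝ | |p.1 + p.2| ≤ δ}) (measurableSet_le (by fun_prop) (by fun_prop)) (c := ENNReal.ofReal (2 * δ)) (by
        intro ω _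
        have e : P {ω' | (B (5/2) ω, B 3 ω' - B (5/2) ω') ∈ {p : ℝ × ℝ | |p.1 + p.2| ≤ δ}} =
          gaussianReal 0 (3 - 5/2 : ℝ).toNNReal (Icc (-δ - B (5/2) ω) (δ - B (5/2) ω)) := by
          rw [← hB.incr_law (5/2) 3 (by norm_num) (by norm_num), Measure.map_apply hY measurableSet_Icc]
          congr 1
          ext ω'
          simp only [mem_ofPred_eq, abs_le, mem_preimage, mem_Icc]
          constructor <;> rintro ⟨a, b⟩ <;> constructor <;> linarith
        rw [e]
        refine (gauss_window_le ?_).trans (le_of_eq ?_)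
        · rw [Real.coe_toNNReal _ (by norm_num)]; nlinarith [Real.pi_gt_three]
        · congr 1; ring)
    simpa using this
  have m2 : MeasurableSet[natSigma B 3] ((staySet B 1 δ 0 ∩ O) ∩ {ω | |B 3 ω| ≤ δ}) := by
    refine (natSigma_mono (by norm_num) _ m1).inter ?_
    have : MeasurableSet {x : ℝ | |x| ≤ δ} := measurableSet_le (by fun_prop) measurable_const
    exact meas_natSigma (B := B) (u := 3) (by norm_num) le_rfl this
  have m3 : MeasurableSet[procSigma (shiftP B 3)] (stayInf (shiftP B 3) (2 * δ) (δ / 3)) :=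
    measurableSet_stayInf' fun q a => meas_procSigma a
  have hi := hB.indep_shift (s := 3) (by norm_num)
  rw [(Indep_iff _ _ _).1 hi.symm _ _ m2 m3]
  have hs : IsBrownianMotion P (shiftP B 3) := hB.shift (by norm_num)
  have s2 : P (stayInf (shiftP B 3) (2 * δ) (δ / 3)) ≤ ENNReal.ofReal (4 * (2 * δ) * (δ / 3)) := by
    have := hs.q_le0 (g := 2 * δ) (b := δ / 3) (by positivity) (by positivity)
    exact (ENNReal.le_ofReal_iff_toReal_le (measure_ne_top _ _) (by positivity)).2 this
  calc _ ≤ ENNReal.ofReal (2 * δ) * ENNReal.ofReal (2 * δ * p) * ENNReal.ofReal (4 * (2 * δ) * (δ / 3)) := by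
        gcongr
        exact s1.trans (by gcongr)
    _ = ENNReal.ofReal (2 * δ * (2 * δ * p) * (4 * (2 * δ) * (δ / 3))) := by
        rw [← ENNReal.ofReal_mul (by positivity), ← ENNReal.ofReal_mul (by positivity)]
    _ ≤ _ := by
        apply ENNReal.ofReal_le_ofReal
        have : 0 ≤ δ ^ 4 * p := by positivity
        nlinarith

/-- base event: the behaviour away from time 2 -/
def baseSet (B : ℝ → Ω → ℝ) (δ : ℝ) : Set Ω :=
  staySet B 1 δ 0 ∩ {ω | |B 3 ω| ≤ δ} ∩ stayInf (shiftP B 3) (2 * δ) (δ / 3)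

/-- ring event -/
def ringSet (B : ℝ → Ω → ℝ) (θ : ℝ) : Set Ω :=
  {ω | (B (2 - θ) ω + B (2 + θ) ω) / 2 < -1/4 ∧
    ∃ q : ℚ, 0 ≤ (q:ℝ) ∧ (q:ℝ) ≤ 8 * θ ∧ ((q:ℝ) ≤ 3 * θ ∨ 5 * θ ≤ (q:ℝ)) ∧ 0 < B (2 - 4 * θ + q) ω}

lemma ring_sub_osc {θ : ℝ} : ringSet B θ ⊆ oscSet B θ := by
  rintro ω ⟨h1, q, q0, q1, -, h2⟩
  by_contra hc
  simp only [oscSet, mem_ofPred_eq, not_or, not_exists, not_and, not_lt, shiftP] at hc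
  obtain ⟨c1, c2, c3⟩ := hc
  have c1 := abs_le.1 (c1 q q0 q1)
  have e1 : 2 - 4 * θ + 3 * θ = 2 - θ := by ring
  have e2 : 2 - 4 * θ + 5 * θ = 2 + θ := by ring
  rw [e1] at c2; rw [e2] at c3
  have c2 := abs_le.1 c2
  have c3 := abs_le.1 c3
  linarith [c1.1, c1.2, c2.1, c2.2, c3.1, c3.2]

lemma ring_meas {θ : ℝ} (h0 : 0 < θ) (h1 : 4 * θ ≤ 1) : MeasurableSet[procSigma (perp B θ)] (ringSet B θ) := by
  have e : ringSet B θ = {ω | (B (2 - θ) ω + B (2 + θ) ω) / 2 < -1/4} ∩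
    ⋃ q : ℚ, ⋃ (_ : 0 ≤ (q:ℝ)), ⋃ (_ : (q:ℝ) ≤ 8 * θ), ⋃ (_ : (q:ℝ) ≤ 3 * θ ∨ 5 * θ ≤ (q:ℝ)), {ω | 0 < B (2 - 4 * θ + q) ω} := by
    ext ω; simp only [ringSet, mem_ofPred_eq, mem_inter_iff, mem_iUnion, exists_prop]
  rw [e]
  refine MeasurableSet.inter ?_ (MeasurableSet.iUnion fun q => MeasurableSet.iUnion fun a => MeasurableSet.iUnion fun b =>
    MeasurableSet.iUnion fun c => ?_)
  · have a1 := meas_perp_left (B := B) h0 (show 0 ≤ 2 - θ by linarith) le_rfl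
    have a2 := meas_perp_right (B := B) h0 (le_refl (2 + θ))
    exact ((a1.add a2).div_const 2) measurableSet_Iio
  · rcases c with c | c
    · exact meas_perp_left (B := B) h0 (v := 2 - 4 * θ + q) (by linarith) (by linarith) measurableSet_Ioi
    · exact meas_perp_right (B := B) h0 (v := 2 - 4 * θ + q) (by linarith) measurableSet_Ioi

lemma base_meas {θ δ : ℝ} (h0 : 0 < θ) (h1 : 4 * θ ≤ 1) : MeasurableSet[procSigma (perp B θ)] (baseSet B δ) := by
  refine MeasurableSet.inter (MeasurableSet.inter ?_ ?_) ?_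
  · exact measurableSet_staySet' fun q a b => meas_perp_left h0 a (by linarith)
  · have : MeasurableSet {x : ℝ | |x| ≤ δ} := measurableSet_le (by fun_prop) measurable_const
    exact meas_perp_right (B := B) h0 (v := 3) (by linarith) this
  · exact measurableSet_stayInf' fun q a => (meas_perp_right (B := B) h0 (by linarith)).sub (meas_perp_right (B := B) h0 (by linarith))

end part8

section part9
open scoped NNReal ENNReal
set_option linter.unusedSectionVars false
variable {Ω : Type*} {mΩ : MeasurableSpace Ω} {P : Measure Ω} {B : ℝ → Ω → ℝ}

/-- dyadic scale -/
noncomputable def rad (n : ℕ) : ℝ := (1/2) ^ (n + 1)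

lemma rad_pos (n : ℕ) : 0 < rad n := by unfold rad; positivity
lemma rad_le (n : ℕ) : rad n ≤ 1/2 := by
  unfold rad; rw [pow_succ]
  have : ((1:ℝ)/2) ^ n ≤ 1 := pow_le_one₀ (by norm_num) (by norm_num)
  linarith
lemma rad_sq_le (n : ℕ) : 4 * rad n ^ 2 ≤ 1 := by nlinarith [rad_pos n, rad_le n]
lemma rad_succ (n : ℕ) : rad n ^ 2 = 4 * rad (n + 1) ^ 2 := by
  unfold rad; rw [pow_succ (1/2 : ℝ) (n+1)]; ring
lemma rad_tendsto : Tendsto rad atTop (𝓝 0) := by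
  have := (tendsto_pow_atTop_nhds_zero_of_lt_one (r := (1/2:ℝ)) (by norm_num) (by norm_num))
  exact (tendsto_add_atTop_iff_nat 1).2 this

lemma rad_tsum : ∑' n, ENNReal.ofReal (rad n) = 1 := by
  have h : HasSum rad 1 := by
    have h1 := hasSum_geometric_two.mul_left (1/2:ℝ)
    have h2 : rad = fun n => (1/2:ℝ) * (1/2) ^ n := by
      funext n; unfold rad; rw [pow_succ]; ring
    have e : (1/2:ℝ) * 2 = 1 := by norm_num
    rw [e] at h1; rw [h2]; exact h1
  rw [← ENNReal.ofReal_tsum_of_nonneg (fun n => (rad_pos n).le) h.summable, h.tsum_eq]; simp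

/-- the ring event with scale 0 trivial -/
def ringN (B : ℝ → Ω → ℝ) (n : ℕ) : Set Ω := if n = 0 then univ else ringSet B (rad n ^ 2)

lemma path_cover {δ : ℝ} (hδ4 : δ ≤ 1/4) {J : Set ℝ} (hJ1 : J ⊆ Ioc 1 2) {ω : Ω}
    (hf : GoodPath (fun u => B u ω)) (h3 : Xproc B 3 ω ≤ δ) (h2 : Xproc B 2 ω ∈ J) :
    ∃ n, ω ∈ (baseSet B δ ∩ {ω | centre B (rad n ^ 2) ω - zeta B (rad n ^ 2) ω ∈ J ∧ zeta B (rad n ^ 2) ω ∈ Iic (-1/4)}) ∪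
      (baseSet B δ ∩ ringN B n ∩ {ω | centre B (rad n ^ 2) ω - zeta B (rad n ^ 2) ω ∈ J ∧ zeta B (rad n ^ 2) ω ∈ univ}) := by
  have a1 : B 3 ω ≤ Kproc B 3 ω := hf.f_le_K (t := 3) (by norm_num)
  have a2 : 0 ≤ Kproc B 3 ω := hf.K_nonneg (by norm_num)
  have a3 : Kproc B 2 ω ≤ Kproc B 3 ω := hf.K_mono (by norm_num) (by norm_num) (by norm_num)
  have a4 : 2 * Kproc B 3 ω - B 3 ω ≤ δ := h3
  have a5 : 1 < 2 * Kproc B 2 ω - B 2 ω := (hJ1 h2).1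
  have hK : Kproc B 3 ω ≤ δ := by linarith
  have hb2 : B 2 ω < -1/4 := by linarith
  have hbase : ω ∈ baseSet B δ := by
    refine ⟨⟨fun q q0 q1 => ?_, ?_⟩, fun q q0 => ?_⟩
    · have := hf.f_le_K (t := q) q0
      have t2 := hf.K_mono (v := q) (w := 3) q0 (by norm_num) (by linarith)
      have t3 : B q ω ≤ Kproc B 3 ω := this.trans t2
      linarith
    · show |B 3 ω| ≤ δ
      rw [abs_le]; constructor <;> linarith
    · have t1 : B (3 + q) ω ≤ Kproc B (3 + q) ω := hf.f_le_K (t := 3 + q) (by linarith)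
      have t2 : Kproc B (3 + q) ω ≤ (3 + q) / 3 * Kproc B 3 ω := hf.K_le_mul (by norm_num) (by linarith)
      have t3 : (3 + (q:ℝ)) / 3 * Kproc B 3 ω ≤ (3 + q) / 3 * δ := by gcongr
      show B (3 + q) ω - B 3 ω ≤ 2 * δ + δ / 3 * q
      linarith
  have hex : ∃ n, ∀ u, 2 - rad n ^ 2 ≤ u → u ≤ 2 + rad n ^ 2 → B u ω ≤ 0 := by
    have hc : ContinuousAt (fun u => B u ω) 2 := hf.cont.continuousAt (Ici_mem_nhds (by norm_num))
    have h1 : ∀ᶠ u in 𝓝 (2:ℝ), B u ω < 0 := hc.eventually_lt continuousAt_const (by linarith)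
    obtain ⟨ε, he, hε⟩ := Metric.eventually_nhds_iff.1 h1
    obtain ⟨n, hn⟩ := (rad_tendsto.eventually (gt_mem_nhds he)).exists
    refine ⟨n, fun u u1 u2 => (hε ?_).le⟩
    have : rad n ^ 2 ≤ rad n := by nlinarith [rad_pos n, rad_le n]
    rw [Real.dist_eq, abs_lt]; constructor <;> linarith
  classical
  let n := Nat.find hex
  have hn := Nat.find_spec hex
  have hp : 0 < rad n ^ 2 := by have := rad_pos n; positivity
  have hX := centre_eq hf hp (by linarith [rad_sq_le n]) hn
  rw [hX] at h2
  refine ⟨n, ?_⟩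
  rcases le_or_gt (-1/4) ((B (2 - rad n ^ 2) ω + B (2 + rad n ^ 2) ω) / 2) with hm | hm
  · left
    refine ⟨hbase, h2, ?_⟩
    show zeta B (rad n ^ 2) ω ≤ -1/4
    unfold zeta
    linarith
  · right
    refine ⟨⟨hbase, ?_⟩, h2, trivial⟩
    unfold ringN
    split_ifs with hn0
    · trivial
    refine ⟨hm, ?_⟩
    obtain ⟨k, hk⟩ := Nat.exists_eq_succ_of_ne_zero hn0
    have hkn : ¬ (∀ u, 2 - rad k ^ 2 ≤ u → u ≤ 2 + rad k ^ 2 → B u ω ≤ 0) := Nat.find_min hex (by omega)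
    have hr : rad k ^ 2 = 4 * rad n ^ 2 := by rw [hk]; exact rad_succ k
    set θ := rad n ^ 2
    rw [hr] at hkn
    by_contra hcon
    push Not at hcon
    apply hkn
    intro u u1 u2
    have h8 := rad_sq_le n
    have hcont : ContinuousOn (fun v => B (2 - 4 * θ + v) ω) (Ici 0) :=
      hf.cont.comp (by fun_prop) fun v hv => by simp at hv ⊢; linarith
    rcases le_or_gt u (2 - θ) with c | c
    · have := rat_to_real (f := fun v => B (2 - 4 * θ + v) ω) (l := fun _ => 0) (a := 0) (θ := 3 * θ)
        (hcont.mono Icc_subset_Ici_self) continuous_const (by linarith)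
        (fun q q0 q1 => hcon q q0 (by linarith) (Or.inl q1)) (u - (2 - 4 * θ)) (by linarith) (by linarith)
      simpa using this
    rcases le_or_gt u (2 + θ) with c' | c'
    · exact hn u c.le c'
    · have := rat_to_real (f := fun v => B (2 - 4 * θ + v) ω) (l := fun _ => 0) (a := 5 * θ) (θ := 8 * θ)
        (hcont.mono fun x hx => by have := hx.1; simp; linarith) continuous_const (by linarith)
        (fun q q0 q1 => hcon q (by linarith) (by linarith) (Or.inr q0)) (u - (2 - 4 * θ)) (by linarith) (by linarith)
      simpa using this

/-- The upper bound (U). -/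
lemma IsBrownianMotion.upper [IsProbabilityMeasure P] (hB : IsBrownianMotion P B) {δ : ℝ} (hδ : 0 < δ) (hδ4 : δ ≤ 1/4)
    {J : Set ℝ} (hJ : MeasurableSet J) (hJ1 : J ⊆ Ioc 1 2) :
    P ({ω | Xproc B 3 ω ≤ δ} ∩ {ω | Xproc B 2 ω ∈ J}) ≤ ENNReal.ofReal (22704 * δ ^ 4) * volume J := by
  let S : ℕ → Set Ω := fun n =>
    (baseSet B δ ∩ {ω | centre B (rad n ^ 2) ω - zeta B (rad n ^ 2) ω ∈ J ∧ zeta B (rad n ^ 2) ω ∈ Iic (-1/4)}) ∪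
      (baseSet B δ ∩ ringN B n ∩ {ω | centre B (rad n ^ 2) ω - zeta B (rad n ^ 2) ω ∈ J ∧ zeta B (rad n ^ 2) ω ∈ univ})
  have hcov : P ({ω | Xproc B 3 ω ≤ δ} ∩ {ω | Xproc B 2 ω ∈ J}) ≤ P (⋃ n, S n) := by
    apply measure_mono_ae
    filter_upwards [hB.good] with ω hf hω
    exact mem_iUnion.2 (path_cover hδ4 hJ1 hf hω.1 hω.2)
  have hbase : P (baseSet B δ) ≤ ENNReal.ofReal (11 * δ ^ 4) := by
    have := hB.base_le (p := 1) (O := univ) hδ zero_le_one MeasurableSet.univ (by simpa using hB.stay_one_le hδ)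
    simpa [baseSet] using this
  have hring : ∀ n, P (baseSet B δ ∩ ringN B n) ≤ ENNReal.ofReal (11 * δ ^ 4 * (2048 * rad n ^ 2)) := by
    intro n
    unfold ringN
    split_ifs with h0
    · rw [inter_univ]
      refine hbase.trans (ENNReal.ofReal_le_ofReal ?_)
      have e : rad n = 1/2 := by rw [h0]; simp [rad]
      rw [e]
      have : 0 ≤ δ ^ 4 := by positivity
      nlinarith
    · have hp : 0 < rad n ^ 2 := by have := rad_pos n; positivity
      have h4 := rad_sq_le n
      obtain ⟨k, hk⟩ := Nat.exists_eq_succ_of_ne_zero h0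
      have h5 := rad_sq_le k
      have h6 : rad k ^ 2 = 4 * rad n ^ 2 := by rw [hk]; exact rad_succ k
      rw [h6] at h5
      have hO : MeasurableSet[natSigma B (5/2)] (oscSet B (rad n ^ 2)) :=
        oscSet_meas' hp.le fun v a b => shiftP_meas_nat (by linarith) a (by linarith)
      have := hB.base_le (p := 2048 * rad n ^ 2) (O := oscSet B (rad n ^ 2)) hδ (by positivity) hO
        (hB.stay_osc_le hp h4 hδ)
      refine (measure_mono ?_).trans this
      rintro ω ⟨⟨⟨b1, b2⟩, b3⟩, b4⟩
      exact ⟨⟨⟨b1, ring_sub_osc b4⟩, b2⟩, b3⟩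
  have hS : ∀ n, P (S n) ≤ ENNReal.ofReal (rad n) * (ENNReal.ofReal (22704 * δ ^ 4) * volume J) := by
    intro n
    have hr := rad_pos n
    have hp : 0 < rad n ^ 2 := by positivity
    have h4 := rad_sq_le n
    have hcoe : (((rad n ^ 2 / 2).toNNReal : ℝ≥0) : ℝ) = rad n ^ 2 / 2 := Real.coe_toNNReal _ (by positivity)
    have hpi : rad n ^ 2 ≤ 2 * Real.pi * ((rad n ^ 2 / 2).toNNReal : ℝ≥0) := by
      rw [hcoe]; nlinarith [Real.pi_gt_three]
    have p1 := hB.tent_le hp (by linarith) (base_meas (B := B) (δ := δ) hp h4) hJ (measurableSet_Iic (a := (-1/4:ℝ)))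
      (M := 16 * rad n) (by
        intro z hz
        have hz' : z ≤ -1/4 := hz
        refine (pdf_le_exp hr hpi).trans ?_
        rw [hcoe]
        have e : - z ^ 2 / (2 * (rad n ^ 2 / 2)) = -(z ^ 2 / rad n ^ 2) := by field_simp
        rw [e]
        have hx : 1 / (16 * rad n ^ 2) ≤ z ^ 2 / rad n ^ 2 := by
          rw [div_le_div_iff₀ (by positivity) (by positivity)]
          have : 1/16 ≤ z ^ 2 := by nlinarith
          nlinarith
        have h2 : Real.exp (-(z ^ 2 / rad n ^ 2)) ≤ 16 * rad n ^ 2 := by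
          have h3 : 1 / (16 * rad n ^ 2) ≤ Real.exp (z ^ 2 / rad n ^ 2) :=
            hx.trans (by linarith [Real.add_one_le_exp (z ^ 2 / rad n ^ 2)])
          rw [Real.exp_neg]
          rw [inv_le_comm₀ (Real.exp_pos _) (by positivity)]
          simpa using h3
        calc 1 / rad n * Real.exp (-(z ^ 2 / rad n ^ 2)) ≤ 1 / rad n * (16 * rad n ^ 2) := by gcongr
          _ = 16 * rad n := by field_simp)
    have mr : MeasurableSet[procSigma (perp B (rad n ^ 2))] (ringN B n) := by
      unfold ringN; split_ifs
      · exact MeasurableSet.univ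
      · exact ring_meas hp h4
    have p2 := hB.tent_le hp (by linarith) ((base_meas (B := B) (δ := δ) hp h4).inter mr) hJ MeasurableSet.univ
      (M := 1 / rad n) (fun z _ => pdf_le_of_sq hr hpi)
    refine (measure_union_le _ _).trans ((add_le_add p1 p2).trans ?_)
    calc _ ≤ ENNReal.ofReal (16 * rad n) * volume J * ENNReal.ofReal (11 * δ ^ 4) +
          ENNReal.ofReal (1 / rad n) * volume J * ENNReal.ofReal (11 * δ ^ 4 * (2048 * rad n ^ 2)) := by
          gcongr
          exact hring n
      _ = (ENNReal.ofReal (16 * rad n) * ENNReal.ofReal (11 * δ ^ 4) +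
          ENNReal.ofReal (1 / rad n) * ENNReal.ofReal (11 * δ ^ 4 * (2048 * rad n ^ 2))) * volume J := by ring
      _ = ENNReal.ofReal (rad n * (22704 * δ ^ 4)) * volume J := by
          rw [← ENNReal.ofReal_mul (by positivity), ← ENNReal.ofReal_mul (by positivity),
            ← ENNReal.ofReal_add (by positivity) (by positivity)]
          congr 2
          field_simp; ring
      _ = _ := by rw [ENNReal.ofReal_mul hr.le, mul_assoc]
  calc _ ≤ P (⋃ n, S n) := hcov
    _ ≤ ∑' n, P (S n) := measure_iUnion_le _
    _ ≤ ∑' n, ENNReal.ofReal (rad n) * (ENNReal.ofReal (22704 * δ ^ 4) * volume J) := ENNReal.tsum_le_tsum hS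
    _ = _ := by rw [ENNReal.tsum_mul_right, rad_tsum, one_mul]

end part9

section part10
open scoped NNReal ENNReal
set_option linter.unusedSectionVars false
variable {Ω : Type*} {mΩ : MeasurableSpace Ω} {P : Measure Ω} {B : ℝ → Ω → ℝ}

/-- nonnegative rationals as times -/
abbrev QTime : Type := {q : ℚ // 0 ≤ q}

/-- the shifted path sampled at rational times -/
def samp (B : ℝ → Ω → ℝ) (ω : Ω) : QTime → ℝ := fun q => B ((q : ℚ) : ℝ) ω

lemma samp_meas : Measurable[procSigma B] (samp B) := by
  refine @measurable_pi_lambda _ _ _ (procSigma B) _ _ fun q => ?_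
  exact meas_procSigma (by exact_mod_cast q.2)

/-- `B` stays below level `c` on `[s, s+θ]` and ends in a window. -/
def stepSet (B : ℝ → Ω → ℝ) (s θ c β β' : ℝ) : Set Ω :=
  {ω | (∀ q : ℚ, 0 ≤ (q:ℝ) → (q:ℝ) ≤ θ → B (s + q) ω ≤ c) ∧ B (s + θ) ω ∈ Ioc β β'}

lemma stepSet_meas {s θ c β β' : ℝ} (hs : 0 ≤ s) (hθ : 0 ≤ θ) :
    MeasurableSet[natSigma B (s + θ)] (stepSet B s θ c β β') := by
  refine @MeasurableSet.inter _ (natSigma B (s + θ)) {ω | ∀ q : ℚ, 0 ≤ (q:ℝ) → (q:ℝ) ≤ θ → B (s + q) ω ≤ c}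
    {ω | B (s + θ) ω ∈ Ioc β β'} ?_ ?_
  · have : {ω | ∀ q : ℚ, 0 ≤ (q:ℝ) → (q:ℝ) ≤ θ → B (s + q) ω ≤ c}
      = ⋂ q : ℚ, ⋂ (_ : 0 ≤ (q:ℝ)), ⋂ (_ : (q:ℝ) ≤ θ), {ω | B (s + q) ω ≤ c} := by ext; simp
    rw [this]
    refine MeasurableSet.iInter fun q => MeasurableSet.iInter fun h0 => MeasurableSet.iInter fun h1 => ?_
    exact (meas_natSigma (B := B) (u := s + q) (by linarith) (by linarith)) measurableSet_Iic
  · exact (meas_natSigma (B := B) (u := s + θ) (by linarith) le_rfl) measurableSet_Ioc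

lemma IsBrownianMotion.chain [IsProbabilityMeasure P] (hB : IsBrownianMotion P B) {s θ c β β' a a' R : ℝ}
    (hs : 0 ≤ s) (hθ : 0 < θ) (ha : a' ≤ c) (hβ : β ≤ β') (hβc : β' ≤ c)
    (hR1 : -R ≤ β - a') (hR2 : β' - a ≤ R)
    {E : Set Ω} (hE : MeasurableSet[natSigma B s] E) (hEa : ∀ ω ∈ E, B s ω ∈ Icc a a') :
    ENNReal.ofReal ((1 - Real.exp (-(2 * (c - a') * (c - β') / θ))) *
      (gaussianPDFReal 0 θ.toNNReal R * (β' - β))) * P E ≤ P (E ∩ stepSet B s θ c β β') := by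
  have hS := hB.shift hs
  have hv : θ.toNNReal ≠ 0 := by simpa using hθ
  let RR : Set (ℝ × ((QTime → ℝ) × ℝ)) := {p | (∀ q : QTime, ((q:ℚ):ℝ) ≤ θ → p.2.1 q ≤ c - p.1) ∧
    (β - p.1 < p.2.2 ∧ p.2.2 ≤ β' - p.1)}
  have hRR : MeasurableSet RR := by
    refine MeasurableSet.inter (s₁ := {p : ℝ × ((QTime → ℝ) × ℝ) | ∀ q : QTime, ((q:ℚ):ℝ) ≤ θ → p.2.1 q ≤ c - p.1})
      (s₂ := {p : ℝ × ((QTime → ℝ) × ℝ) | β - p.1 < p.2.2 ∧ p.2.2 ≤ β' - p.1}) ?_ ?_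
    · have : {p : ℝ × ((QTime → ℝ) × ℝ) | ∀ q : QTime, ((q:ℚ):ℝ) ≤ θ → p.2.1 q ≤ c - p.1}
        = ⋂ q : QTime, ⋂ (_ : ((q:ℚ):ℝ) ≤ θ), {p : ℝ × ((QTime → ℝ) × ℝ) | p.2.1 q ≤ c - p.1} := by ext; simp
      rw [this]
      refine MeasurableSet.iInter fun q => MeasurableSet.iInter fun h1 => ?_
      exact measurableSet_le (by fun_prop) (by fun_prop)
    · refine MeasurableSet.inter (s₁ := {p : ℝ × ((QTime → ℝ) × ℝ) | β - p.1 < p.2.2})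
        (s₂ := {p : ℝ × ((QTime → ℝ) × ℝ) | p.2.2 ≤ β' - p.1}) ?_ ?_
      · exact measurableSet_lt (by fun_prop) (by fun_prop)
      · exact measurableSet_le (by fun_prop) (by fun_prop)
  have hY : Measurable[procSigma (shiftP B s)] (fun ω => (samp (shiftP B s) ω, shiftP B s θ ω)) :=
    Measurable.prodMk samp_meas (meas_procSigma hθ.le)
  have key := indep_ge (P := P) (natSigma_le_of_meas hB.measurable s) (procSigma_le_of_meas hS.measurable)
    (hB.indep_shift hs) (X := B s) (Y := fun ω => (samp (shiftP B s) ω, shiftP B s θ ω))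
    (meas_natSigma hs le_rfl)
    hY hE hRR
    (c := ENNReal.ofReal ((1 - Real.exp (-(2 * (c - a') * (c - β') / θ))) *
      (gaussianPDFReal 0 θ.toNNReal R * (β' - β)))) ?_
  · refine key.trans (measure_mono ?_)
    rintro ω ⟨h1, h2, h3, h4⟩
    refine ⟨h1, fun q q0 q1 => ?_, ?_, ?_⟩
    · have := h2 ⟨q, by exact_mod_cast q0⟩ q1
      simp only [samp, shiftP] at this
      linarith
    · simp only [shiftP] at h3; linarith
    · simp only [shiftP] at h4; linarith
  · intro ω hω
    obtain ⟨x1, x2⟩ := hEa ω hω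
    set x := B s ω with hx
    have h1 := hS.stay_window_ge hθ (g := c - x) (y1 := β - x) (y2 := β' - x) (by linarith) (by linarith) (by linarith)
    have h2 := gauss_Ioc_ge hv (a := β - x) (b := β' - x) (R := R) (by linarith) (by linarith)
    rw [← ofReal_measureReal]
    apply ENNReal.ofReal_le_ofReal
    refine le_trans ?_ (h1.trans ?_)
    · have e1 : Real.exp (-(2 * (c - x) * (c - x - (β' - x)) / θ)) ≤ Real.exp (-(2 * (c - a') * (c - β') / θ)) := by
        apply Real.exp_le_exp.2
        have : (c - a') * (c - β') ≤ (c - x) * (c - x - (β' - x)) := by nlinarith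
        rw [neg_le_neg_iff]
        apply div_le_div_of_nonneg_right _ hθ.le
        nlinarith
      have e2 : Real.exp (-(2 * (c - a') * (c - β') / θ)) ≤ 1 := by
        rw [Real.exp_le_one_iff, neg_nonpos]
        apply div_nonneg _ hθ.le
        have : 0 ≤ (c - a') * (c - β') := mul_nonneg (by linarith) (by linarith)
        nlinarith
      have e3 : 0 ≤ gaussianPDFReal 0 θ.toNNReal R * (β' - β) :=
        mul_nonneg (gaussianPDFReal_nonneg _ _ _) (by linarith)
      have e4 : β' - x - (β - x) = β' - β := by ring
      rw [e4] at h2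
      exact mul_le_mul (by linarith) h2 e3 (by linarith)
    · refine measureReal_mono ?_ (measure_ne_top _ _)
      rintro ω' ⟨h3, h4⟩
      refine ⟨fun q hq => ?_, h4.1, h4.2⟩
      have := h3 q (by exact_mod_cast q.2) hq
      simpa [samp, shiftP] using this

lemma IsBrownianMotion.tail [IsProbabilityMeasure P] (hB : IsBrownianMotion P B) {s g b : ℝ}
    (hs : 0 ≤ s) (hg : 0 < g) (hb : 0 < b) {E : Set Ω} (hE : MeasurableSet[natSigma B s] E) :
    ENNReal.ofReal (1 - Real.exp (-(g * b / 2))) * P E ≤ P (E ∩ stayInf (shiftP B s) g b) := by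
  have hS := hB.shift hs
  have m2 : MeasurableSet[procSigma (shiftP B s)] (stayInf (shiftP B s) g b) :=
    measurableSet_stayInf' fun q h => meas_procSigma h
  have := (Indep_iff _ _ _).1 (hB.indep_shift hs).symm _ _ hE m2
  rw [this, mul_comm]
  gcongr
  rw [← ofReal_measureReal]
  exact ENNReal.ofReal_le_ofReal (hS.q_ge hg hb)

lemma chain_pos {x θ R w : ℝ} (hx : 0 < x) (hθ : 0 < θ) (hw : 0 < w) :
    0 < ENNReal.ofReal ((1 - Real.exp (-(x / θ))) * (gaussianPDFReal 0 θ.toNNReal R * w)) := by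
  rw [ENNReal.ofReal_pos]
  have h1 : Real.exp (-(x / θ)) < 1 := by
    rw [Real.exp_lt_one_iff]; have : 0 < x / θ := by positivity
    linarith
  have h2 := gaussianPDFReal_pos 0 θ.toNNReal R (by simpa using hθ)
  have : 0 < 1 - Real.exp (-(x / θ)) := by linarith
  positivity

lemma tail_pos {g b : ℝ} (hg : 0 < g) (hb : 0 < b) : 0 < ENNReal.ofReal (1 - Real.exp (-(g * b / 2))) := by
  rw [ENNReal.ofReal_pos]
  have h1 : Real.exp (-(g * b / 2)) < 1 := by
    rw [Real.exp_lt_one_iff]; have : 0 < g * b / 2 := by positivity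
    linarith
  linarith

lemma IsBrownianMotion.start [IsProbabilityMeasure P] (hB : IsBrownianMotion P B) :
    P {ω | B 0 ω = 0} = 1 := by
  have := prob_compl_eq_zero_iff (μ := P) (s := {ω | B 0 ω = 0}) (hB.measurable 0 (measurableSet_singleton 0))
  rw [← this]
  exact hB.init

lemma start_meas : MeasurableSet[natSigma B 0] {ω | B 0 ω = 0} :=
  meas_natSigma (B := B) le_rfl le_rfl (measurableSet_singleton 0)

lemma step_real {s θ c β β' : ℝ} {ω : Ω} (hc : ContinuousOn (fun t => B t ω) (Ici 0)) (hs : 0 ≤ s) (hθ : 0 < θ)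
    (h : ω ∈ stepSet B s θ c β β') {v : ℝ} (h0 : s ≤ v) (hv : v ≤ s + θ) : B v ω ≤ c := by
  have hcont : ContinuousOn (fun v => B (s + v) ω) (Icc 0 θ) :=
    hc.comp (by fun_prop) fun v hv => by have := hv.1; simp; linarith
  have := rat_to_real (l := fun _ => c) hcont continuous_const hθ h.1 (v - s) (by linarith) (by linarith)
  simpa using this

lemma tail_real {s g b : ℝ} {ω : Ω} (hc : ContinuousOn (fun t => B t ω) (Ici 0)) (hs : 0 ≤ s)
    (h : ω ∈ stayInf (shiftP B s) g b) {v : ℝ} (h0 : s ≤ v) : B v ω ≤ B s ω + g + b * (v - s) := by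
  have hcont : ContinuousOn (fun v => shiftP B s v ω) (Ici 0) := by
    refine ContinuousOn.sub (hc.comp (by fun_prop) fun v hv => ?_) continuousOn_const
    have : 0 ≤ v := hv
    simp; linarith
  have := stayInf_real hcont h (v := v - s) (by linarith)
  simp only [shiftP] at this
  rw [show s + (v - s) = v by ring] at this
  linarith

/-- The lower bound (L). -/
lemma IsBrownianMotion.lower [IsProbabilityMeasure P] (hB : IsBrownianMotion P B) :
    ∃ c : ℝ, 0 < c ∧ ∀ J : Set ℝ, MeasurableSet J → J ⊆ Ioc 1 2 →
      ENNReal.ofReal c * volume J ≤ P {ω | Xproc B 2 ω ∈ J} := by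
  let G : Set Ω := {ω | centre B (1/2) ω ∈ Icc 0 1} ∩ {ω | ∀ q : ℚ, (3/2:ℝ) ≤ q → (q:ℝ) ≤ 5/2 → perp B (1/2) q ω ≤ 0}
  have hG : MeasurableSet[procSigma (perp B (1/2))] G := by
    refine @MeasurableSet.inter _ (procSigma (perp B (1/2))) _ _ (centre_meas (by norm_num) (by norm_num) measurableSet_Icc) ?_
    have : {ω | ∀ q : ℚ, (3/2:ℝ) ≤ q → (q:ℝ) ≤ 5/2 → perp B (1/2) q ω ≤ 0}
      = ⋂ q : ℚ, ⋂ (_ : (3/2:ℝ) ≤ q), ⋂ (_ : (q:ℝ) ≤ 5/2), {ω | perp B (1/2) q ω ≤ 0} := by ext; simp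
    rw [this]
    refine MeasurableSet.iInter fun q => MeasurableSet.iInter fun h0 => MeasurableSet.iInter fun h1 => ?_
    exact meas_procSigma (B := perp B (1/2)) (u := q) (by linarith) measurableSet_Iic
  have hpos : 0 < P G := by
    have m0 := start_meas (B := B)
    have s1 := hB.chain (s := 0) (θ := 3/2) (c := 1/16) (β := -1/2) (β' := -3/8) (a := 0) (a' := 0) (R := 1)
      le_rfl (by norm_num) (by norm_num) (by norm_num) (by norm_num) (by norm_num) (by norm_num) m0
      (fun ω h => by rw [show B 0 ω = 0 from h]; simp)
    have m1 : MeasurableSet[natSigma B (3/2)] ({ω | B 0 ω = 0} ∩ stepSet B 0 (3/2) (1/16) (-1/2) (-3/8)) := by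
      refine @MeasurableSet.inter _ (natSigma B (3/2)) _ _ (natSigma_mono (by norm_num) _ m0) ?_
      have := stepSet_meas (B := B) (s := 0) (θ := 3/2) (c := 1/16) (β := -1/2) (β' := -3/8) le_rfl (by norm_num)
      rwa [zero_add] at this
    have s2 := hB.chain (s := 3/2) (θ := 1/2) (c := 0) (β := -1/4) (β' := -1/8) (a := -1/2) (a' := -3/8) (R := 1)
      (by norm_num) (by norm_num) (by norm_num) (by norm_num) (by norm_num) (by norm_num) (by norm_num) m1
      (fun ω h => by have := h.2.2; rw [zero_add] at this; exact ⟨this.1.le, this.2⟩)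
    have m2 : MeasurableSet[natSigma B 2] ({ω | B 0 ω = 0} ∩ stepSet B 0 (3/2) (1/16) (-1/2) (-3/8) ∩
        stepSet B (3/2) (1/2) 0 (-1/4) (-1/8)) := by
      refine @MeasurableSet.inter _ (natSigma B 2) _ _ (natSigma_mono (by norm_num) _ m1) ?_
      have := stepSet_meas (B := B) (s := 3/2) (θ := 1/2) (c := 0) (β := -1/4) (β' := -1/8) (by norm_num) (by norm_num)
      rwa [show (3/2:ℝ) + 1/2 = 2 by norm_num] at this
    have s3 := hB.chain (s := 2) (θ := 1/2) (c := 0) (β := -1/2) (β' := -3/8) (a := -1/4) (a' := -1/8) (R := 1)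
      (by norm_num) (by norm_num) (by norm_num) (by norm_num) (by norm_num) (by norm_num) (by norm_num) m2
      (fun ω h => by
        have := h.2.2; rw [show (3/2:ℝ) + 1/2 = 2 by norm_num] at this; exact ⟨this.1.le, this.2⟩)
    have m3 : MeasurableSet[natSigma B (5/2)] ({ω | B 0 ω = 0} ∩ stepSet B 0 (3/2) (1/16) (-1/2) (-3/8) ∩
        stepSet B (3/2) (1/2) 0 (-1/4) (-1/8) ∩ stepSet B 2 (1/2) 0 (-1/2) (-3/8)) := by
      refine @MeasurableSet.inter _ (natSigma B (5/2)) _ _ (natSigma_mono (by norm_num) _ m2) ?_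
      have := stepSet_meas (B := B) (s := 2) (θ := 1/2) (c := 0) (β := -1/2) (β' := -3/8) (by norm_num) (by norm_num)
      rwa [show (2:ℝ) + 1/2 = 5/2 by norm_num] at this
    have s4 := hB.tail (s := 5/2) (g := 1/4) (b := 1/32) (by norm_num) (by norm_num) (by norm_num) m3
    have p0 : 0 < P {ω | B 0 ω = 0} := by rw [hB.start]; norm_num
    have p1 := (ENNReal.mul_pos (chain_pos (by norm_num) (by norm_num) (by norm_num)).ne' p0.ne').trans_le s1
    have p2 := (ENNReal.mul_pos (chain_pos (by norm_num) (by norm_num) (by norm_num)).ne' p1.ne').trans_le s2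
    have p3 := (ENNReal.mul_pos (chain_pos (by norm_num) (by norm_num) (by norm_num)).ne' p2.ne').trans_le s3
    have p4 := (ENNReal.mul_pos (tail_pos (by norm_num) (by norm_num)).ne' p3.ne').trans_le s4
    refine p4.trans_le (measure_mono_ae ?_)
    filter_upwards [hB.good] with ω hf hω
    obtain ⟨⟨⟨⟨h0, h1⟩, h2⟩, h3⟩, h4⟩ := hω
    have b1 : B (3/2) ω ∈ Ioc (-1/2) (-3/8) := by simpa using h1.2
    have b2 : B 2 ω ∈ Ioc (-1/4) (-1/8) := by
      have := h2.2; rwa [show (3/2:ℝ) + 1/2 = 2 by norm_num] at this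
    have b3 : B (5/2) ω ∈ Ioc (-1/2) (-3/8) := by
      have := h3.2; rwa [show (2:ℝ) + 1/2 = 5/2 by norm_num] at this
    have hneg : ∀ u, (3/2:ℝ) ≤ u → u ≤ 5/2 → B u ω ≤ 0 := by
      intro u u1 u2
      rcases le_or_gt u 2 with c | c
      · exact step_real hf.cont (by norm_num) (by norm_num) h2 u1 (by linarith)
      · exact step_real hf.cont (by norm_num) (by norm_num) h3 c.le (by linarith)
    have hline : ∀ u, 0 ≤ u → B u ω ≤ 1/16 + 1/32 * u := by
      intro u u0
      rcases le_or_gt u (3/2) with c | c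
      · have := step_real hf.cont (by norm_num) (by norm_num) h1 u0 (by linarith); linarith
      rcases le_or_gt u (5/2) with c' | c'
      · have := hneg u c.le c'; linarith
      · have := tail_real hf.cont (by norm_num) h4 c'.le
        have := b3.2
        linarith
    have k1 : Kproc B 2 ω ≤ 1/16 + 1/32 * 2 := K_le_line hline (by norm_num)
    have k2 : 0 ≤ Kproc B 2 ω := hf.K_nonneg (by norm_num)
    have ce := centre_eq (B := B) (θ := 1/2) hf (by norm_num) (by norm_num)
      (fun u u1 u2 => hneg u (by linarith) (by linarith))
    have xe : Xproc B 2 ω = 2 * Kproc B 2 ω - B 2 ω := rfl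
    have ze : zeta B (1/2) ω = 1 * B 2 ω + (-1/2) * B (3/2) ω + (-1/2) * B (5/2) ω := by
      unfold zeta; norm_num
    refine ⟨⟨?_, ?_⟩, fun q q1 q2 => ?_⟩
    · have := b1.2; have := b3.2; linarith
    · have := b1.1; have := b3.1; linarith
    · have hz : 0 ≤ zeta B (1/2) ω := by
        have := b1.2; have := b3.2; have := b2.1; linarith
      have := mul_nonneg (tent_nonneg (θ := 1/2) (v := q)) hz
      have := hneg q q1 q2
      unfold perp; linarith
  refine ⟨gaussianPDFReal 0 ((1/2:ℝ) / 2).toNNReal 2 * P.real G, ?_, fun J hJ hJ1 => ?_⟩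
  · have := gaussianPDFReal_pos 0 ((1/2:ℝ) / 2).toNNReal 2 (by simp)
    have : 0 < P.real G := ENNReal.toReal_pos hpos.ne' (measure_ne_top _ _)
    positivity
  · have h := hB.tent_ge (θ := 1/2) (by norm_num) (by norm_num) hG hJ (R := 2) (by
      rintro ω ⟨⟨c1, c2⟩, -⟩ x hx
      have := hJ1 hx
      rw [abs_le]; constructor <;> linarith [this.1, this.2])
    rw [ENNReal.ofReal_mul (gaussianPDFReal_nonneg _ _ _), ofReal_measureReal, mul_assoc, mul_comm (P G), ← mul_assoc]
    refine h.trans (measure_mono_ae ?_)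
    filter_upwards [hB.good] with ω hf hω
    obtain ⟨⟨⟨c1, c2⟩, hp⟩, hj⟩ := hω
    have hj' : centre B (1/2) ω - zeta B (1/2) ω ∈ J := hj
    have hz : zeta B (1/2) ω ≤ 0 := by have := (hJ1 hj').1; linarith
    have hneg : ∀ u, (3/2:ℝ) ≤ u → u ≤ 5/2 → B u ω ≤ 0 := by
      refine rat_to_real (f := fun u => B u ω) (l := fun _ => 0)
        (hf.cont.mono fun x hx => by have := hx.1; simp; linarith) continuous_const (by norm_num) fun q q1 q2 => ?_
      have h1 := hp q q1 q2
      have h2 := mul_nonneg (tent_nonneg (θ := 1/2) (v := q)) (neg_nonneg.2 hz)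
      unfold perp at h1; linarith
    show Xproc B 2 ω ∈ J
    rw [centre_eq (B := B) (θ := 1/2) hf (by norm_num) (by norm_num)
      (fun u u1 u2 => hneg u (by linarith) (by linarith))]
    exact hj'

end part10

section part11
open scoped NNReal ENNReal
set_option linter.unusedSectionVars false
variable {Ω : Type*} {mΩ : MeasurableSpace Ω} {P : Measure Ω} {B : ℝ → Ω → ℝ}

lemma one_sub_exp_ge {x : ℝ} (h0 : 0 ≤ x) (h1 : x ≤ 1) : x / 2 ≤ 1 - Real.exp (-x) := by
  have h2 := Real.add_one_le_exp x
  have h3 : Real.exp (-x) ≤ 1 / (1 + x) := by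
    rw [Real.exp_neg, ← one_div]
    apply one_div_le_one_div_of_le <;> linarith
  have h4 : 1 / (1 + x) ≤ 1 - x / 2 := by
    rw [div_le_iff₀ (by linarith)]
    nlinarith
  linarith

/-- probability of the target event for the path after time 1 -/
lemma IsBrownianMotion.p_ge [IsProbabilityMeasure P] (hB : IsBrownianMotion P B) {γ β δ : ℝ}
    (hγ : 0 ≤ γ) (hγ1 : γ ≤ 1/10) (hβ : 0 < β) (hβ1 : β ≤ 1) (hδ : 0 < δ) (hδ1 : δ ≤ 1/4) :
    ENNReal.ofReal (gaussianPDFReal 0 1 2 ^ 2 * (27/8000) * δ ^ 3 * γ * β) ≤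
      P (stayInf B γ β ∩ {ω | B 1 ω ∈ Ioc (-9/5) (-6/5)} ∩ {ω | B 2 ω ∈ Ioc (-δ/2) (-δ/4)}) := by
  have m0 := start_meas (B := B)
  have s1 := hB.chain (s := 0) (θ := 1) (c := γ) (β := -9/5) (β' := -6/5) (a := 0) (a' := 0) (R := 2)
    le_rfl (by norm_num) hγ (by norm_num) (by linarith) (by norm_num) (by norm_num) m0
    (fun ω h => by rw [show B 0 ω = 0 from h]; simp)
  have m1 : MeasurableSet[natSigma B 1] ({ω | B 0 ω = 0} ∩ stepSet B 0 1 γ (-9/5) (-6/5)) := by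
    refine @MeasurableSet.inter _ (natSigma B 1) _ _ (natSigma_mono (by norm_num) _ m0) ?_
    have := stepSet_meas (B := B) (s := 0) (θ := 1) (c := γ) (β := -9/5) (β' := -6/5) le_rfl (by norm_num)
    rwa [zero_add] at this
  have s2 := hB.chain (s := 1) (θ := 1) (c := 0) (β := -δ/2) (β' := -δ/4) (a := -9/5) (a' := -6/5) (R := 2)
    (by norm_num) (by norm_num) (by norm_num) (by linarith) (by linarith) (by linarith) (by linarith) m1
    (fun ω h => by have := h.2.2; rw [zero_add] at this; exact ⟨this.1.le, this.2⟩)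
  have m2 : MeasurableSet[natSigma B 2] ({ω | B 0 ω = 0} ∩ stepSet B 0 1 γ (-9/5) (-6/5) ∩
      stepSet B 1 1 0 (-δ/2) (-δ/4)) := by
    refine @MeasurableSet.inter _ (natSigma B 2) _ _ (natSigma_mono (by norm_num) _ m1) ?_
    have := stepSet_meas (B := B) (s := 1) (θ := 1) (c := 0) (β := -δ/2) (β' := -δ/4) (by norm_num) (by norm_num)
    rwa [show (1:ℝ) + 1 = 2 by norm_num] at this
  have s3 := hB.tail (s := 2) (g := δ/4) (b := β) (by norm_num) (by positivity) hβ m2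
  rw [hB.start, mul_one] at s1
  have e1 : (1:ℝ).toNNReal = 1 := by simp
  rw [e1] at s1 s2
  set c0 := gaussianPDFReal 0 1 2 with hc0
  have hc : 0 ≤ c0 := gaussianPDFReal_nonneg _ _ _
  have q1 : 6/5 * γ ≤ 1 - Real.exp (-(2 * (γ - 0) * (γ - -6/5) / 1)) := by
    have := one_sub_exp_ge (x := 2 * (γ - 0) * (γ - -6/5) / 1) (by nlinarith) (by nlinarith)
    nlinarith
  have q2 : 3/10 * δ ≤ 1 - Real.exp (-(2 * ((0:ℝ) - -6/5) * (0 - -δ/4) / 1)) := by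
    have := one_sub_exp_ge (x := 2 * ((0:ℝ) - -6/5) * (0 - -δ/4) / 1) (by nlinarith) (by nlinarith)
    nlinarith
  have q3 : δ * β / 16 ≤ 1 - Real.exp (-(δ/4 * β / 2)) := by
    have hp : 0 < δ * β := by positivity
    have := one_sub_exp_ge (x := δ/4 * β / 2) (by nlinarith) (by nlinarith)
    nlinarith
  have t1 : ENNReal.ofReal (6/5 * γ * (c0 * (3/5))) ≤ P ({ω | B 0 ω = 0} ∩ stepSet B 0 1 γ (-9/5) (-6/5)) := by
    refine le_trans (ENNReal.ofReal_le_ofReal ?_) s1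
    rw [show ((-6/5:ℝ) - -9/5) = 3/5 by norm_num]
    gcongr
  have t2 : ENNReal.ofReal (3/10 * δ * (c0 * (δ/4))) * ENNReal.ofReal (6/5 * γ * (c0 * (3/5))) ≤
      P ({ω | B 0 ω = 0} ∩ stepSet B 0 1 γ (-9/5) (-6/5) ∩ stepSet B 1 1 0 (-δ/2) (-δ/4)) := by
    refine le_trans (mul_le_mul' (ENNReal.ofReal_le_ofReal ?_) t1) s2
    rw [show (-δ/4 - -δ/2) = δ/4 by ring]
    gcongr
  have t3 : ENNReal.ofReal (δ * β / 16) * (ENNReal.ofReal (3/10 * δ * (c0 * (δ/4))) * ENNReal.ofReal (6/5 * γ * (c0 * (3/5)))) ≤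
      P ({ω | B 0 ω = 0} ∩ stepSet B 0 1 γ (-9/5) (-6/5) ∩ stepSet B 1 1 0 (-δ/2) (-δ/4) ∩ stayInf (shiftP B 2) (δ/4) β) :=
    le_trans (mul_le_mul' (ENNReal.ofReal_le_ofReal q3) t2) s3
  rw [← ENNReal.ofReal_mul (by positivity), ← ENNReal.ofReal_mul (by positivity)] at t3
  refine le_trans (le_of_eq ?_) (t3.trans (measure_mono_ae ?_))
  · congr 1; ring
  filter_upwards [hB.good] with ω hf hω
  obtain ⟨⟨⟨h0, h1⟩, h2⟩, h3⟩ := hω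
  have b1 : B 1 ω ∈ Ioc (-9/5) (-6/5) := by simpa using h1.2
  have b2 : B 2 ω ∈ Ioc (-δ/2) (-δ/4) := by
    have := h2.2; rwa [show (1:ℝ) + 1 = 2 by norm_num] at this
  refine ⟨⟨fun q q0 => ?_, b1⟩, b2⟩
  have hq : 0 ≤ β * q := by positivity
  rcases le_or_gt (q:ℝ) 1 with c | c
  · have := step_real hf.cont (by norm_num) (by norm_num) h1 q0 (by linarith); linarith
  rcases le_or_gt (q:ℝ) 2 with c' | c'
  · have := step_real hf.cont (by norm_num) (by norm_num) h2 c.le (by linarith); linarith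
  · have := tail_real hf.cont (by norm_num) h3 c'.le
    have := b2.2
    linarith

/-- height at time 1 -/
noncomputable def kA (B : ℝ → Ω → ℝ) (ε : ℝ) (ω : Ω) : ℝ := (ε + B 1 ω) / 2
/-- gap at time 1 -/
noncomputable def gA (B : ℝ → Ω → ℝ) (ε : ℝ) (ω : Ω) : ℝ := (ε - B 1 ω) / 2
/-- maximal slope -/
noncomputable def bA (B : ℝ → Ω → ℝ) (ε : ℝ) (ω : Ω) : ℝ :=
  ⨅ q : {q : ℚ // 0 ≤ (q:ℝ) ∧ (q:ℝ) < 1}, (kA B ε ω - B ((q:ℚ):ℝ) ω) / (1 - ((q:ℚ):ℝ))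

lemma kA_meas {ε : ℝ} : Measurable[natSigma B 1] (kA B ε) := by
  have := meas_natSigma (B := B) (u := 1) (s := 1) (by norm_num) le_rfl
  exact (Measurable.const_add this _).div_const _

lemma gA_meas {ε : ℝ} : Measurable[natSigma B 1] (gA B ε) := by
  have := meas_natSigma (B := B) (u := 1) (s := 1) (by norm_num) le_rfl
  exact (Measurable.const_sub this _).div_const _

lemma bA_meas {ε : ℝ} : Measurable[natSigma B 1] (bA B ε) := by
  unfold bA
  refine Measurable.iInf fun q => ?_
  exact ((kA_meas).sub (meas_natSigma q.2.1 q.2.2.le)).div_const _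

/-- the past event -/
def dA (B : ℝ → Ω → ℝ) (ε : ℝ) : Set Ω :=
  {ω | B 0 ω = 0} ∩ {ω | ∀ q : ℚ, 0 ≤ (q:ℝ) → (q:ℝ) < 1 → B q ω ≤ kA B ε ω - bA B ε ω * (1 - q)} ∩
    {ω | 0 ≤ gA B ε ω} ∩ {ω | 0 < bA B ε ω}

lemma dA_meas {ε : ℝ} : MeasurableSet[natSigma B 1] (dA B ε) := by
  have h1 : MeasurableSet[natSigma B 1] {ω | ∀ q : ℚ, 0 ≤ (q:ℝ) → (q:ℝ) < 1 → B q ω ≤ kA B ε ω - bA B ε ω * (1 - q)} := by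
    have : {ω | ∀ q : ℚ, 0 ≤ (q:ℝ) → (q:ℝ) < 1 → B q ω ≤ kA B ε ω - bA B ε ω * (1 - q)}
      = ⋂ q : ℚ, ⋂ (_ : 0 ≤ (q:ℝ)), ⋂ (_ : (q:ℝ) < 1), {ω | B q ω ≤ kA B ε ω - bA B ε ω * (1 - q)} := by ext; simp
    rw [this]
    refine MeasurableSet.iInter fun q => MeasurableSet.iInter fun h0 => MeasurableSet.iInter fun h1 => ?_
    exact measurableSet_le (meas_natSigma h0 h1.le) (kA_meas.sub (bA_meas.mul_const _))
  have h2 : MeasurableSet[natSigma B 1] {ω | B 0 ω = 0} := natSigma_mono (by norm_num) _ start_meas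
  exact ((h2.inter h1).inter (gA_meas measurableSet_Ici)).inter (bA_meas measurableSet_Ioi)

/-- line constraint set -/
def rS : Set ((ℝ × ℝ) × (QTime → ℝ)) := {p | ∀ q : QTime, p.2 q ≤ p.1.1 + p.1.2 * ((q:ℚ):ℝ)}

lemma rS_meas : MeasurableSet rS := by
  have : rS = ⋂ q : QTime, {p : (ℝ × ℝ) × (QTime → ℝ) | p.2 q ≤ p.1.1 + p.1.2 * ((q:ℚ):ℝ)} := by
    ext; simp [rS]
  rw [this]
  exact MeasurableSet.iInter fun q => measurableSet_le (by fun_prop) (by fun_prop)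

/-- target constraint set -/
def rT (δ : ℝ) : Set ((ℝ × ℝ) × (QTime → ℝ)) :=
  rS ∩ {p | p.2 ⟨1, by norm_num⟩ ∈ Ioc (-9/5) (-6/5)} ∩ {p | p.2 ⟨2, by norm_num⟩ ∈ Ioc (-δ/2) (-δ/4)}

lemma rT_meas {δ : ℝ} : MeasurableSet (rT δ) := by
  refine (rS_meas.inter ?_).inter ?_
  · have h : Measurable fun p : (ℝ × ℝ) × (QTime → ℝ) => p.2 ⟨1, by norm_num⟩ := by fun_prop
    exact h measurableSet_Ioc
  · have h : Measurable fun p : (ℝ × ℝ) × (QTime → ℝ) => p.2 ⟨2, by norm_num⟩ := by fun_prop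
    exact h measurableSet_Ioc

lemma mem_rS {W : ℝ → Ω → ℝ} {g b : ℝ} {ω : Ω} : ((g, b), samp W ω) ∈ rS ↔ ω ∈ stayInf W g b := by
  constructor
  · intro h q hq
    exact h ⟨q, by exact_mod_cast hq⟩
  · intro h q
    exact h q (by exact_mod_cast q.2)

lemma mem_rT {W : ℝ → Ω → ℝ} {g b δ : ℝ} {ω : Ω} : ((g, b), samp W ω) ∈ rT δ ↔
    ω ∈ stayInf W g b ∩ {ω | W 1 ω ∈ Ioc (-9/5) (-6/5)} ∩ {ω | W 2 ω ∈ Ioc (-δ/2) (-δ/4)} := by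
  have h1 : samp W ω ⟨1, by norm_num⟩ = W 1 ω := by simp [samp]
  have h2 : samp W ω ⟨2, by norm_num⟩ = W 2 ω := by simp [samp]
  rw [mem_inter_iff, mem_inter_iff, ← mem_rS]
  have h3 : W 1 ω ∈ Ioc (-9/5 : ℝ) (-6/5) ↔ samp W ω ⟨1, by norm_num⟩ ∈ Ioc (-9/5 : ℝ) (-6/5) := by rw [h1]
  have h4 : W 2 ω ∈ Ioc (-δ/2) (-δ/4) ↔ samp W ω ⟨2, by norm_num⟩ ∈ Ioc (-δ/2) (-δ/4) := by rw [h2]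
  exact (and_congr (and_congr Iff.rfl h3) h4).symm

lemma A_sub {ε : ℝ} {ω : Ω} (hf : GoodPath (fun u => B u ω)) (h : Xproc B 1 ω ≤ ε) :
    ω ∈ dA B ε ∧ ω ∈ stayInf (shiftP B 1) (gA B ε ω) (bA B ε ω) := by
  obtain ⟨b, hb, hl⟩ := hf.support (s := 1) (by norm_num)
  have hk : concaveMajorant (fun u => B u ω) 1 ≤ kA B ε ω := by
    have : 2 * concaveMajorant (fun u => B u ω) 1 - B 1 ω ≤ ε := h
    unfold kA; linarith
  have hK : B 1 ω ≤ concaveMajorant (fun u => B u ω) 1 := hf.f_le_K (t := 1) (by norm_num)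
  have hl' : ∀ u, 0 ≤ u → B u ω ≤ kA B ε ω + b * (u - 1) := fun u hu => by
    have := hl u hu; linarith
  have hi : ∀ q : {q : ℚ // 0 ≤ (q:ℝ) ∧ (q:ℝ) < 1}, b ≤ (kA B ε ω - B ((q:ℚ):ℝ) ω) / (1 - ((q:ℚ):ℝ)) := by
    intro q
    have := q.2.2
    rw [le_div_iff₀ (by linarith)]
    have := hl' q q.2.1
    linarith
  have : Nonempty {q : ℚ // 0 ≤ (q:ℝ) ∧ (q:ℝ) < 1} := ⟨⟨0, by simp⟩⟩
  have hb' : b ≤ bA B ε ω := le_ciInf hi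
  have hgk : gA B ε ω = kA B ε ω - B 1 ω := by unfold gA kA; ring
  refine ⟨⟨⟨⟨hf.zero, fun q q0 q1 => ?_⟩, ?_⟩, hb.trans_le hb'⟩, fun q q0 => ?_⟩
  · have : bA B ε ω ≤ (kA B ε ω - B q ω) / (1 - q) :=
      ciInf_le (⟨b, by rintro _ ⟨q, rfl⟩; exact hi q⟩) (⟨q, q0, q1⟩ : {q : ℚ // 0 ≤ (q:ℝ) ∧ (q:ℝ) < 1})
    rw [le_div_iff₀ (by linarith)] at this
    linarith
  · show 0 ≤ gA B ε ω
    rw [hgk]; linarith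
  · have h1 := hl' (1 + q) (by linarith)
    have h2 := mul_le_mul_of_nonneg_right hb' q0
    show B (1 + q) ω - B 1 ω ≤ _
    rw [hgk]; linarith

lemma D_bounds {ε : ℝ} {ω : Ω} (h : ω ∈ dA B ε) :
    0 ≤ gA B ε ω ∧ gA B ε ω ≤ ε ∧ 0 < bA B ε ω ∧ bA B ε ω ≤ kA B ε ω ∧ kA B ε ω ≤ ε := by
  obtain ⟨⟨⟨h0, h1⟩, h2⟩, h3⟩ := h
  have h0' : B 0 ω = 0 := h0
  have h2' : 0 ≤ gA B ε ω := h2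
  have h3' : 0 < bA B ε ω := h3
  have := h1 0 (by simp) (by simp)
  simp only [Rat.cast_zero] at this
  rw [h0'] at this
  have e : gA B ε ω + kA B ε ω = ε := by unfold gA kA; ring
  refine ⟨h2', by linarith, h3', by linarith, by linarith⟩

lemma T_sub {δ ε : ℝ} {ω : Ω} (hε : ε = δ / 16) (hδ : 0 < δ) (hδ1 : δ ≤ 1/4) (hf : GoodPath (fun u => B u ω)) (hD : ω ∈ dA B ε)
    (hT : ω ∈ stayInf (shiftP B 1) (gA B ε ω) (bA B ε ω) ∩ {ω | shiftP B 1 1 ω ∈ Ioc (-9/5) (-6/5)} ∩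
      {ω | shiftP B 1 2 ω ∈ Ioc (-δ/2) (-δ/4)}) :
    Xproc B 1 ω ≤ ε ∧ Xproc B 2 ω ∈ Ioc 1 2 ∧ Xproc B 3 ω ≤ δ := by
  obtain ⟨g0, g1, b0, b1, k1⟩ := D_bounds hD
  obtain ⟨⟨h1, h2⟩, h3⟩ := hT
  have h2' : B (1 + 1) ω - B 1 ω ∈ Ioc (-9/5) (-6/5) := h2
  have h3' : B (1 + 2) ω - B 1 ω ∈ Ioc (-δ/2) (-δ/4) := h3
  rw [show (1:ℝ) + 1 = 2 by norm_num] at h2'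
  rw [show (1:ℝ) + 2 = 3 by norm_num] at h3'
  have hkB : kA B ε ω = (ε + B 1 ω) / 2 := rfl
  have hgB : gA B ε ω = (ε - B 1 ω) / 2 := rfl
  have hline : ∀ u, 0 ≤ u → B u ω ≤ (kA B ε ω - bA B ε ω) + bA B ε ω * u := by
    intro u u0
    rcases lt_or_ge u 1 with c | c
    · refine rat_to_real (f := fun u => B u ω) (l := fun u => (kA B ε ω - bA B ε ω) + bA B ε ω * u)
        (a := 0) (θ := (1 + u) / 2) (hf.cont.mono Icc_subset_Ici_self) (by fun_prop) (by linarith)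
        (fun q q0 q1 => ?_) u u0 (by linarith)
      have := hD.1.1.2 q q0 (by linarith)
      linarith
    · have := tail_real hf.cont (by norm_num) h1 c
      linarith
  have K1 : Kproc B 1 ω ≤ (kA B ε ω - bA B ε ω) + bA B ε ω * 1 := K_le_line hline (by norm_num)
  have K2 : Kproc B 2 ω ≤ (kA B ε ω - bA B ε ω) + bA B ε ω * 2 := K_le_line hline (by norm_num)
  have K3 : Kproc B 3 ω ≤ (kA B ε ω - bA B ε ω) + bA B ε ω * 3 := K_le_line hline (by norm_num)
  have K2' : 0 ≤ Kproc B 2 ω := hf.K_nonneg (by norm_num)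
  have e1 : Xproc B 1 ω = 2 * Kproc B 1 ω - B 1 ω := rfl
  have e2 : Xproc B 2 ω = 2 * Kproc B 2 ω - B 2 ω := rfl
  have e3 : Xproc B 3 ω = 2 * Kproc B 3 ω - B 3 ω := rfl
  refine ⟨by linarith, ⟨?_, ?_⟩, ?_⟩
  · rw [e2]; linarith [h2'.2]
  · rw [e2]; linarith [h2'.1]
  · rw [e3]; linarith [h3'.1]

/-- The conditional lower bound (A). -/
lemma IsBrownianMotion.assoc [IsProbabilityMeasure P] (hB : IsBrownianMotion P B) {δ : ℝ} (hδ : 0 < δ) (hδ1 : δ ≤ 1/4) :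
    ENNReal.ofReal (gaussianPDFReal 0 1 2 ^ 2 * (27/32000) * δ ^ 3) * P {ω | Xproc B 1 ω ≤ δ / 16} ≤
      P ({ω | Xproc B 1 ω ≤ δ / 16} ∩ {ω | Xproc B 2 ω ∈ Ioc 1 2} ∩ {ω | Xproc B 3 ω ≤ δ}) := by
  set ε := δ / 16 with hε
  have hS : IsBrownianMotion P (shiftP B 1) := hB.shift (by norm_num)
  have hX : Measurable[natSigma B 1] (fun ω => (gA B ε ω, bA B ε ω)) := Measurable.prodMk gA_meas bA_meas
  have hc : 0 ≤ gaussianPDFReal 0 1 2 := gaussianPDFReal_nonneg _ _ _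
  have l1 := indep_lint (P := P) (natSigma_le_of_meas hB.measurable 1) (procSigma_le_of_meas hS.measurable)
    (hB.indep_shift (s := 1) (by norm_num)) hX (Y := samp (shiftP B 1)) samp_meas (dA_meas (B := B) (ε := ε)) rS_meas
  have l2 := indep_lint (P := P) (natSigma_le_of_meas hB.measurable 1) (procSigma_le_of_meas hS.measurable)
    (hB.indep_shift (s := 1) (by norm_num)) hX (Y := samp (shiftP B 1)) samp_meas (dA_meas (B := B) (ε := ε)) (rT_meas (δ := δ))
  have mD : MeasurableSet (dA B ε) := natSigma_le_of_meas hB.measurable 1 _ dA_meas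
  have u1 : P {ω | Xproc B 1 ω ≤ ε} ≤ ∫⁻ ω in dA B ε, ENNReal.ofReal (4 * gA B ε ω * bA B ε ω) ∂P := by
    calc _ ≤ P (dA B ε ∩ {ω | ((gA B ε ω, bA B ε ω), samp (shiftP B 1) ω) ∈ rS}) := by
          apply measure_mono_ae
          filter_upwards [hB.good] with ω hf hω
          obtain ⟨a, b⟩ := A_sub hf hω
          exact ⟨a, mem_rS.2 b⟩
      _ ≤ _ := by
          rw [l1]
          apply setLIntegral_mono' mD
          intro ω hω
          obtain ⟨g0, g1, b0, b1, k1⟩ := D_bounds hω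
          have e : {ω' | ((gA B ε ω, bA B ε ω), samp (shiftP B 1) ω') ∈ rS} = stayInf (shiftP B 1) (gA B ε ω) (bA B ε ω) := by
            ext ω'; exact mem_rS
          rw [e, ← ofReal_measureReal]
          apply ENNReal.ofReal_le_ofReal
          have := hS.q_le (gA B ε ω) (bA B ε ω)
          rwa [max_eq_left g0, max_eq_left b0.le] at this
  have u2 : ∫⁻ ω in dA B ε, ENNReal.ofReal (gaussianPDFReal 0 1 2 ^ 2 * (27/8000) * δ ^ 3 * gA B ε ω * bA B ε ω) ∂P ≤
      P ({ω | Xproc B 1 ω ≤ ε} ∩ {ω | Xproc B 2 ω ∈ Ioc 1 2} ∩ {ω | Xproc B 3 ω ≤ δ}) := by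
    calc _ ≤ P (dA B ε ∩ {ω | ((gA B ε ω, bA B ε ω), samp (shiftP B 1) ω) ∈ rT δ}) := by
          rw [l2]
          apply setLIntegral_mono' mD
          intro ω hω
          obtain ⟨g0, g1, b0, b1, k1⟩ := D_bounds hω
          refine (hS.p_ge g0 (by linarith) b0 (by linarith) hδ hδ1).trans (le_of_eq ?_)
          congr 1
          ext ω'; exact mem_rT.symm
      _ ≤ _ := by
          apply measure_mono_ae
          filter_upwards [hB.good] with ω hf hω
          obtain ⟨a, b, c⟩ := T_sub hε hδ hδ1 hf hω.1 (mem_rT.1 hω.2)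
          exact ⟨⟨a, b⟩, c⟩
  refine le_trans ?_ u2
  refine (mul_le_mul_right u1 _).trans ?_
  rw [← lintegral_const_mul' _ _ ENNReal.ofReal_ne_top]
  apply setLIntegral_mono' mD
  intro ω hω
  rw [← ENNReal.ofReal_mul (by positivity)]
  apply le_of_eq
  congr 1; ring

lemma IsBrownianMotion.A_pos [IsProbabilityMeasure P] (hB : IsBrownianMotion P B) {ε : ℝ} (hε : 0 < ε) :
    0 < P {ω | Xproc B 1 ω ≤ ε} := by
  have m0 := start_meas (B := B)
  have s1 := hB.chain (s := 0) (θ := 1) (c := ε/8) (β := -ε/8) (β' := -ε/16) (a := 0) (a' := 0) (R := ε)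
    le_rfl (by norm_num) (by linarith) (by linarith) (by linarith) (by linarith) (by linarith) m0
    (fun ω h => by rw [show B 0 ω = 0 from h]; simp)
  have m1 : MeasurableSet[natSigma B 1] ({ω | B 0 ω = 0} ∩ stepSet B 0 1 (ε/8) (-ε/8) (-ε/16)) := by
    refine @MeasurableSet.inter _ (natSigma B 1) _ _ (natSigma_mono (by norm_num) _ m0) ?_
    have := stepSet_meas (B := B) (s := 0) (θ := 1) (c := ε/8) (β := -ε/8) (β' := -ε/16) le_rfl (by norm_num)
    rwa [zero_add] at this
  have s4 := hB.tail (s := 1) (g := ε/8) (b := ε/8) (by norm_num) (by positivity) (by positivity) m1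
  have p0 : 0 < P {ω | B 0 ω = 0} := by rw [hB.start]; norm_num
  have p1 := (ENNReal.mul_pos (chain_pos (by nlinarith [mul_pos hε hε]) (by norm_num) (by linarith)).ne' p0.ne').trans_le s1
  have p4 := (ENNReal.mul_pos (tail_pos (by positivity) (by positivity)).ne' p1.ne').trans_le s4
  refine p4.trans_le (measure_mono_ae ?_)
  filter_upwards [hB.good] with ω hf hω
  obtain ⟨⟨h0, h1⟩, h4⟩ := hω
  have b1 : B 1 ω ∈ Ioc (-ε/8) (-ε/16) := by simpa using h1.2
  have hline : ∀ u, 0 ≤ u → B u ω ≤ ε/8 + ε/8 * u := by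
    intro u u0
    have := mul_nonneg hε.le u0
    rcases le_or_gt u 1 with c | c
    · have := step_real hf.cont (by norm_num) (by norm_num) h1 u0 (by linarith); linarith
    · have := tail_real hf.cont (by norm_num) h4 c.le
      have := b1.2
      linarith
  have k1 : Kproc B 1 ω ≤ ε/8 + ε/8 * 1 := K_le_line hline (by norm_num)
  show 2 * Kproc B 1 ω - B 1 ω ≤ ε
  linarith [b1.1]

end part11

section part12
open scoped NNReal ENNReal
set_option linter.unusedSectionVars false
variable {Ω : Type*} {mΩ : MeasurableSpace Ω} {P : Measure Ω} {B : ℝ → Ω → ℝ}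

lemma real_bound [IsProbabilityMeasure P] {C : Set Ω} {Y : Ω → ℝ} {u c : ℝ} (hu : 0 ≤ u) (hc : 0 < c)
    (hU : ∀ J : Set ℝ, MeasurableSet J → J ⊆ Ioc 1 2 → P (C ∩ {ω | Y ω ∈ J}) ≤ ENNReal.ofReal u * volume J)
    (hL : ∀ J : Set ℝ, MeasurableSet J → J ⊆ Ioc 1 2 → ENNReal.ofReal c * volume J ≤ P {ω | Y ω ∈ J})
    (J : Set ℝ) (hJ : MeasurableSet J) (hJ1 : J ⊆ Ioc 1 2) :
    P.real (C ∩ {ω | Y ω ∈ J}) ≤ P.real {ω | Y ω ∈ J} * (u / c) := by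
  have hv : volume J ≠ ∞ := ((measure_mono hJ1).trans_lt (by simp)).ne
  have h1 := ENNReal.toReal_mono (by finiteness) (hU J hJ hJ1)
  have h2 := ENNReal.toReal_mono (measure_ne_top _ _) (hL J hJ hJ1)
  rw [ENNReal.toReal_mul, ENNReal.toReal_ofReal hu] at h1
  rw [ENNReal.toReal_mul, ENNReal.toReal_ofReal hc.le] at h2
  calc P.real (C ∩ {ω | Y ω ∈ J}) ≤ u * (volume J).toReal := h1
    _ = c * (volume J).toReal * (u / c) := by field_simp
    _ ≤ _ := by gcongr; exact h2

lemma cond_bound [IsProbabilityMeasure P] {C A : Set Ω} {Y : Ω → ℝ} (hY : Measurable Y) (hC : MeasurableSet C)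
    (hA : MeasurableSet A) {M : ℝ} (hM : 0 ≤ M)
    (h : ∀ J : Set ℝ, MeasurableSet J → J ⊆ Ioc 1 2 → P.real (C ∩ {ω | Y ω ∈ J}) ≤ P.real {ω | Y ω ∈ J} * M)
    (hci : P[(C ∩ A).indicator (fun _ => (1:ℝ))|MeasurableSpace.comap Y inferInstance] =ᵐ[P]
      P[C.indicator (fun _ => (1:ℝ))|MeasurableSpace.comap Y inferInstance] *
      P[A.indicator (fun _ => (1:ℝ))|MeasurableSpace.comap Y inferInstance]) :
    P.real (C ∩ A ∩ {ω | Y ω ∈ Ioc 1 2}) ≤ M * P.real A := by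
  set m := MeasurableSpace.comap Y (inferInstance : MeasurableSpace ℝ) with hm
  have hle : m ≤ mΩ := hY.comap_le
  set I : Set Ω := {ω | Y ω ∈ Ioc 1 2} with hI
  have mI : MeasurableSet[m] I := ⟨Ioc 1 2, measurableSet_Ioc, rfl⟩
  set f := P[C.indicator (fun _ => (1:ℝ))|m] with hf
  set a := P[A.indicator (fun _ => (1:ℝ))|m] with ha
  have iC : ∀ S : Set Ω, MeasurableSet[mΩ] S → Integrable (S.indicator (fun _ => (1:ℝ))) P := fun S hS =>
    (integrable_const (1:ℝ)).indicator hS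
  have key : ∀ S T : Set Ω, MeasurableSet[mΩ] S → MeasurableSet[m] T →
      ∫ ω in T, (P[S.indicator (fun _ => (1:ℝ))|m]) ω ∂P = P.real (S ∩ T) := by
    intro S T hS hT
    rw [setIntegral_condExp hle (iC S hS) hT, integral_indicator_const _ hS]
    simp [measureReal_restrict_apply hS]
  have fm : StronglyMeasurable[m] f := stronglyMeasurable_condExp
  have hle1 : ∀ᵐ ω ∂(P.restrict I), f ω ≤ M := by
    by_contra hcon
    have h0 : (P.restrict I) {ω | M < f ω} ≠ 0 := by
      intro h0; apply hcon
      rw [ae_iff]; simpa using h0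
    have mS : MeasurableSet[m] {ω | M < f ω} := fm.measurable measurableSet_Ioi
    have := setIntegral_gt_gt (μ := P.restrict I) (f := f) hM integrable_condExp.restrict.integrableOn h0
    rw [Measure.restrict_restrict (hle _ mS), key C _ hC (mS.inter mI), measureReal_restrict_apply (hle _ mS)] at this
    obtain ⟨J0, hJ0, e⟩ := mS
    have e2 : {ω | M < f ω} ∩ I = {ω | Y ω ∈ J0 ∩ Ioc 1 2} := by rw [← e]; rfl
    have h3 := h (J0 ∩ Ioc 1 2) (hJ0.inter measurableSet_Ioc) inter_subset_right
    rw [← e2] at h3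
    linarith
  have a0 : 0 ≤ᵐ[P] a := condExp_nonneg (ae_of_all _ fun ω => indicator_nonneg (fun _ _ => zero_le_one) ω)
  have ia : Integrable a P := integrable_condExp
  calc P.real (C ∩ A ∩ I) = ∫ ω in I, (P[(C ∩ A).indicator (fun _ => (1:ℝ))|m]) ω ∂P := (key _ _ (hC.inter hA) mI).symm
    _ ≤ ∫ ω in I, M * a ω ∂P := by
        refine setIntegral_mono_ae_restrict integrable_condExp.integrableOn (ia.const_mul M).integrableOn ?_
        filter_upwards [ae_restrict_of_ae hci, hle1, ae_restrict_of_ae a0] with ω h1 h2 h3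
        rw [h1]
        exact mul_le_mul_of_nonneg_right h2 h3
    _ = M * P.real (A ∩ I) := by rw [integral_const_mul, key _ _ hA mI]
    _ ≤ _ := by
        gcongr
        · exact measure_ne_top _ _
        · exact inter_subset_left

lemma main_aux [StandardBorelSpace Ω] [IsProbabilityMeasure P] (hB : IsBrownianMotion P B) :
    ¬ IsMarkov P (Xproc B) := by
  intro hMk
  obtain ⟨c, hc, hL⟩ := hB.lower
  have hp : 0 < gaussianPDFReal 0 1 2 := gaussianPDFReal_pos 0 1 2 one_ne_zero
  set c1 := gaussianPDFReal 0 1 2 ^ 2 * (27/32000) with hc1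
  have hc1p : 0 < c1 := by positivity
  set δ := min (1/4) (c1 * c / 45408) with hδ
  have hδ0 : 0 < δ := lt_min (by norm_num) (by positivity)
  have hδ4 : δ ≤ 1/4 := min_le_left _ _
  have hδc : δ ≤ c1 * c / 45408 := min_le_right _ _
  have mX : ∀ s : ℝ, 0 ≤ s → Measurable (Xproc B s) := fun s hs => by
    obtain ⟨h, -⟩ := hMk s s hs le_rfl
    exact measurable_iff_comap_le.2 h
  obtain ⟨h2, hci⟩ := hMk 2 3 (by norm_num) (by norm_num)
  have mN : natSigma (Xproc B) 2 ≤ mΩ := by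
    refine iSup_le fun u => (mX u u.2.1).comap_le
  have m3 : MeasurableSet[MeasurableSpace.comap (Xproc B 3) inferInstance] {ω | Xproc B 3 ω ≤ δ} :=
    ⟨Iic δ, measurableSet_Iic, rfl⟩
  have m1 : MeasurableSet[natSigma (Xproc B) 2] {ω | Xproc B 1 ω ≤ δ / 16} :=
    meas_natSigma (B := Xproc B) (u := 1) (by norm_num) (by norm_num) measurableSet_Iic
  have hci' := (condIndep_iff _ _ _ h2 (mX 3 (by norm_num)).comap_le mN P).1 hci _ _ m3 m1
  have hb := cond_bound (mX 2 (by norm_num)) (mX 3 (by norm_num) measurableSet_Iic) (mN _ m1)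
    (M := 22704 * δ ^ 4 / c) (by positivity)
    (real_bound (by positivity) hc (fun J hJ hJ1 => hB.upper hδ0 hδ4 hJ hJ1) hL) hci'
  have has := ENNReal.toReal_mono (measure_ne_top _ _) (hB.assoc hδ0 hδ4)
  rw [ENNReal.toReal_mul, ENNReal.toReal_ofReal (by positivity)] at has
  have hA : 0 < P.real {ω | Xproc B 1 ω ≤ δ / 16} :=
    ENNReal.toReal_pos (hB.A_pos (by positivity)).ne' (measure_ne_top _ _)
  have e : {ω | Xproc B 1 ω ≤ δ / 16} ∩ {ω | Xproc B 2 ω ∈ Ioc 1 2} ∩ {ω | Xproc B 3 ω ≤ δ} =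
      {ω | Xproc B 3 ω ≤ δ} ∩ {ω | Xproc B 1 ω ≤ δ / 16} ∩ {ω | Xproc B 2 ω ∈ Ioc 1 2} := by
    ext ω; simp only [mem_inter_iff]; tauto
  rw [e] at has
  have h5 : c1 * δ ^ 3 * P.real {ω | Xproc B 1 ω ≤ δ / 16} ≤ 22704 * δ ^ 4 / c * P.real {ω | Xproc B 1 ω ≤ δ / 16} :=
    has.trans hb
  have h6 := le_of_mul_le_mul_right h5 hA
  rw [le_div_iff₀ hc] at h6
  have h7 : δ ^ 3 * (c1 * c) ≤ δ ^ 3 * (22704 * δ) := by nlinarith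
  have h8 := le_of_mul_le_mul_left h7 (by positivity)
  have : 0 < c1 * c := by positivity
  linarith

end part12

/-- The process `X = 2K - B` is not Markov. -/
theorem two_K_sub_B_not_markov {Ω : Type*} [MeasurableSpace Ω] [StandardBorelSpace Ω]
    (P : Measure Ω) [IsProbabilityMeasure P] (B : ℝ → Ω → ℝ)
    (hB : IsBrownianMotion P B) :
    ¬ IsMarkov P (Xproc B) := by
  exact main_aux hB
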